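/- arXiv:2506.07415 — 2 statements merged into one kernel-verified Lean document; each statement's English description precedes it below -/
import Mathlib

section
/- Let b>0. Assume f satisfies (A1), g satisfies (A2) with exponent α>2, and u₀ satisfies (B2). Then there exists a viscosity solution u:(−b,b)×[0,∞)→ℝ of the initial value problem u_t − f(g(u_x)u_{xx}) = 0 in Q, with the singular Dirichlet condition lim_{x→±b}u(x,t)=∞ for every t>0, and initial datum u₀. -/
open Filter Set Topology

noncomputable section

/-- The parabolic cylinder `Q = (-b,b) × (0,∞)`. -/
def Qset (b : ℝ) : Set (ℝ × ℝ) := Ioo (-b) b ×ˢ Ioi (0:ℝ)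

/-- The cylinder `Q₀ = (-b,b) × [0,∞)`. -/
def Q0set (b : ℝ) : Set (ℝ × ℝ) := Ioo (-b) b ×ˢ Ici (0:ℝ)

/-- Partial derivative in time. -/
def pT (φ : ℝ × ℝ → ℝ) (p : ℝ × ℝ) : ℝ := deriv (fun t => φ (p.1, t)) p.2

/-- Partial derivative in space. -/
def pX (φ : ℝ × ℝ → ℝ) (p : ℝ × ℝ) : ℝ := deriv (fun x => φ (x, p.2)) p.1

/-- Second partial derivative in space. -/
def pXX (φ : ℝ × ℝ → ℝ) (p : ℝ × ℝ) : ℝ := deriv (fun x => pX φ (x, p.2)) p.1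

/-- (A1): `f` is continuous, strictly increasing, `f 0 = 0`, `f(s) → ±∞` as `s → ±∞`. -/
def A1 (f : ℝ → ℝ) : Prop :=
  Continuous f ∧ StrictMono f ∧ f 0 = 0 ∧ Tendsto f atTop atTop ∧ Tendsto f atBot atBot

/-- (A2) with exponent `α`: `g` is continuous, positive, and `|s|^α g(s)` has positive
limits as `s → ±∞`. -/
def A2 (g : ℝ → ℝ) (α : ℝ) : Prop :=
  Continuous g ∧ (∀ s, 0 < g s) ∧
  ∃ Cgp Cgm : ℝ, 0 < Cgp ∧ 0 < Cgm ∧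
    Tendsto (fun s => |s| ^ α * g s) atTop (𝓝 Cgp) ∧
    Tendsto (fun s => |s| ^ α * g s) atBot (𝓝 Cgm)

/-- (A3) with exponent `β > 0`: `|s|^(-β) f s → ±C_{f±}` as `s → ±∞`. -/
def A3 (f : ℝ → ℝ) (β : ℝ) : Prop :=
  0 < β ∧ ∃ Cfp Cfm : ℝ, 0 < Cfp ∧ 0 < Cfm ∧
    Tendsto (fun s => |s| ^ (-β) * f s) atTop (𝓝 Cfp) ∧
    Tendsto (fun s => |s| ^ (-β) * f s) atBot (𝓝 (-Cfm))

/-- (B1): `u₀ ∈ C([-b,b])`. -/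
def B1 (b : ℝ) (u0 : ℝ → ℝ) : Prop := ContinuousOn u0 (Icc (-b) b)

/-- (B2): `u₀ ∈ C((-b,b))`, diverging to `∞` at `±b` with polynomial rate bound. -/
def B2 (b : ℝ) (u0 : ℝ → ℝ) : Prop :=
  ContinuousOn u0 (Ioo (-b) b) ∧
  Tendsto u0 (𝓝[<] b) atTop ∧ Tendsto u0 (𝓝[>] (-b)) atTop ∧
  ∃ γ : ℝ, 0 < γ ∧
    (∃ C : ℝ, ∀ᶠ x in 𝓝[<] b, u0 x * (b - x) ^ γ ≤ C) ∧
    (∃ C : ℝ, ∀ᶠ x in 𝓝[>] (-b), u0 x * (b + x) ^ γ ≤ C)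

/-- `ψ_γ(s) = s^(-γ)` for `γ > 0` and `ψ₀(s) = -log s`. -/
def psi (γ : ℝ) (s : ℝ) : ℝ := if 0 < γ then s ^ (-γ) else -Real.log s

/-- (B3): `u₀ ∈ C((-b,b))` behaves like `D₊ ψ_{γ₊}(b-x)` near `b` and like
`D₋ ψ_{γ₋}(b+x)` near `-b`, up to constants. -/
def B3 (b : ℝ) (u0 : ℝ → ℝ) (γp γm Dp Dm : ℝ) : Prop :=
  ContinuousOn u0 (Ioo (-b) b) ∧ 0 ≤ γp ∧ 0 ≤ γm ∧ 0 < Dp ∧ 0 < Dm ∧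
  ∃ Cp Cm : ℝ,
    Tendsto (fun x => u0 x - Dp * psi γp (b - x)) (𝓝[<] b) (𝓝 Cp) ∧
    Tendsto (fun x => u0 x - Dm * psi γm (b + x)) (𝓝[>] (-b)) (𝓝 Cm)

/-- Viscosity sub-solution of `u_t - f(g(u_x) u_{xx}) = 0` in `Q`. -/
def IsSubSol (b : ℝ) (f g : ℝ → ℝ) (u : ℝ × ℝ → ℝ) : Prop :=
  UpperSemicontinuousOn u (Q0set b) ∧
  ∀ φ : ℝ × ℝ → ℝ, ContDiffOn ℝ 2 φ (Qset b) →
    ∀ p ∈ Qset b, IsLocalMaxOn (fun q => u q - φ q) (Qset b) p →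
      pT φ p - f (g (pX φ p) * pXX φ p) ≤ 0

/-- The singular Dirichlet boundary condition at time `t`:
`v(x,t) → ∞` as `x → ±b`. -/
def SingularBC (b : ℝ) (v : ℝ × ℝ → ℝ) (t : ℝ) : Prop :=
  Tendsto (fun x => v (x, t)) (𝓝[<] b) atTop ∧
  Tendsto (fun x => v (x, t)) (𝓝[>] (-b)) atTop

/-- Viscosity super-solution of `u_t - f(g(u_x) u_{xx}) = 0` in `Q` together with the
singular Dirichlet boundary condition. -/
def IsSuperSol (b : ℝ) (f g : ℝ → ℝ) (v : ℝ × ℝ → ℝ) : Prop :=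
  LowerSemicontinuousOn v (Q0set b) ∧
  (∀ φ : ℝ × ℝ → ℝ, ContDiffOn ℝ 2 φ (Qset b) →
    ∀ p ∈ Qset b, IsLocalMinOn (fun q => v q - φ q) (Qset b) p →
      0 ≤ pT φ p - f (g (pX φ p) * pXX φ p)) ∧
  (∀ t : ℝ, 0 < t → SingularBC b v t)

/-- Upper semicontinuous envelope relative to `Q₀`. -/
def uscEnv (b : ℝ) (u : ℝ × ℝ → ℝ) (p : ℝ × ℝ) : ℝ := limsup u (𝓝[Q0set b] p)

/-- Lower semicontinuous envelope relative to `Q₀`. -/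
def lscEnv (b : ℝ) (u : ℝ × ℝ → ℝ) (p : ℝ × ℝ) : ℝ := liminf u (𝓝[Q0set b] p)

/-- Viscosity solution of the initial value problem: `u*` is a sub-solution, `u_*` is a
super-solution (including the singular Dirichlet condition), and both envelopes agree
with `u₀` at `t = 0`. -/
def IsVSol (b : ℝ) (f g : ℝ → ℝ) (u0 : ℝ → ℝ) (u : ℝ × ℝ → ℝ) : Prop :=
  IsSubSol b f g (uscEnv b u) ∧ IsSuperSol b f g (lscEnv b u) ∧
  ∀ x ∈ Ioo (-b) b, uscEnv b u (x, 0) = u0 x ∧ lscEnv b u (x, 0) = u0 x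

/-! ### Calculus of partial derivatives -/

lemma isOpen_Qset (b : ℝ) : IsOpen (Qset b) := isOpen_Ioo.prod isOpen_Ioi

lemma Qset_sub (b : ℝ) : Qset b ⊆ Q0set b := fun _ h => ⟨h.1, le_of_lt (Set.mem_Ioi.mp h.2)⟩

lemma pX_hasDerivAt {U : Set (ℝ × ℝ)} (hU : IsOpen U) {φ : ℝ × ℝ → ℝ}
    (h : ContDiffOn ℝ 1 φ U) {p : ℝ × ℝ} (hp : p ∈ U) :
    HasDerivAt (fun x => φ (x, p.2)) (fderiv ℝ φ p (1, 0)) p.1 := by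
  have h1 : HasFDerivAt φ (fderiv ℝ φ p) p :=
    ((h.differentiableOn one_ne_zero).differentiableAt (hU.mem_nhds hp)).hasFDerivAt
  have h2 : HasDerivAt (fun x : ℝ => (x, p.2)) ((1 : ℝ), (0 : ℝ)) p.1 :=
    (hasDerivAt_id p.1).prodMk (hasDerivAt_const p.1 p.2)
  exact HasFDerivAt.comp_hasDerivAt (f := fun x : ℝ => (x, p.2)) p.1 h1 h2

lemma pT_hasDerivAt {U : Set (ℝ × ℝ)} (hU : IsOpen U) {φ : ℝ × ℝ → ℝ}
    (h : ContDiffOn ℝ 1 φ U) {p : ℝ × ℝ} (hp : p ∈ U) :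
    HasDerivAt (fun t => φ (p.1, t)) (fderiv ℝ φ p (0, 1)) p.2 := by
  have h1 : HasFDerivAt φ (fderiv ℝ φ p) p :=
    ((h.differentiableOn one_ne_zero).differentiableAt (hU.mem_nhds hp)).hasFDerivAt
  have h2 : HasDerivAt (fun x : ℝ => (p.1, x)) ((0 : ℝ), (1 : ℝ)) p.2 :=
    (hasDerivAt_const p.2 p.1).prodMk (hasDerivAt_id p.2)
  exact HasFDerivAt.comp_hasDerivAt (f := fun x : ℝ => (p.1, x)) p.2 h1 h2

lemma pX_eq {U : Set (ℝ × ℝ)} (hU : IsOpen U) {φ : ℝ × ℝ → ℝ}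
    (h : ContDiffOn ℝ 1 φ U) {p : ℝ × ℝ} (hp : p ∈ U) : pX φ p = fderiv ℝ φ p (1, 0) :=
  (pX_hasDerivAt hU h hp).deriv

lemma pT_eq {U : Set (ℝ × ℝ)} (hU : IsOpen U) {φ : ℝ × ℝ → ℝ}
    (h : ContDiffOn ℝ 1 φ U) {p : ℝ × ℝ} (hp : p ∈ U) : pT φ p = fderiv ℝ φ p (0, 1) :=
  (pT_hasDerivAt hU h hp).deriv

lemma pX_contDiffOn {U : Set (ℝ × ℝ)} (hU : IsOpen U) {φ : ℝ × ℝ → ℝ}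
    (h : ContDiffOn ℝ 2 φ U) : ContDiffOn ℝ 1 (pX φ) U := by
  have h1 : ContDiffOn ℝ 1 (fderiv ℝ φ) U := h.fderiv_of_isOpen hU (by norm_num)
  have h2 : ContDiffOn ℝ 1 (fun p => fderiv ℝ φ p (1, 0)) U := h1.clm_apply contDiffOn_const
  exact h2.congr fun p hp => pX_eq hU (h.of_le (by norm_num)) hp

lemma pX_continuousOn {U : Set (ℝ × ℝ)} (hU : IsOpen U) {φ : ℝ × ℝ → ℝ}
    (h : ContDiffOn ℝ 1 φ U) : ContinuousOn (pX φ) U := by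
  have h1 : ContinuousOn (fderiv ℝ φ) U := h.continuousOn_fderiv_of_isOpen hU (by norm_num)
  exact (h1.clm_apply continuousOn_const).congr fun p hp => pX_eq hU h hp

lemma pT_continuousOn {U : Set (ℝ × ℝ)} (hU : IsOpen U) {φ : ℝ × ℝ → ℝ}
    (h : ContDiffOn ℝ 1 φ U) : ContinuousOn (pT φ) U := by
  have h1 : ContinuousOn (fderiv ℝ φ) U := h.continuousOn_fderiv_of_isOpen hU (by norm_num)
  exact (h1.clm_apply continuousOn_const).congr fun p hp => pT_eq hU h hp

lemma pXX_continuousOn {U : Set (ℝ × ℝ)} (hU : IsOpen U) {φ : ℝ × ℝ → ℝ}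
    (h : ContDiffOn ℝ 2 φ U) : ContinuousOn (pXX φ) U :=
  pX_continuousOn hU (pX_contDiffOn hU h)

lemma pX_sub {U : Set (ℝ × ℝ)} (hU : IsOpen U) {φ ψ : ℝ × ℝ → ℝ}
    (h : ContDiffOn ℝ 1 φ U) (h' : ContDiffOn ℝ 1 ψ U) {p : ℝ × ℝ} (hp : p ∈ U) :
    pX (fun q => φ q - ψ q) p = pX φ p - pX ψ p := by
  have h1 := (pX_hasDerivAt hU h hp).sub (pX_hasDerivAt hU h' hp)
  rw [pX_eq hU h hp, pX_eq hU h' hp, ← h1.deriv]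
  rfl

lemma pT_sub {U : Set (ℝ × ℝ)} (hU : IsOpen U) {φ ψ : ℝ × ℝ → ℝ}
    (h : ContDiffOn ℝ 1 φ U) (h' : ContDiffOn ℝ 1 ψ U) {p : ℝ × ℝ} (hp : p ∈ U) :
    pT (fun q => φ q - ψ q) p = pT φ p - pT ψ p := by
  have h1 := (pT_hasDerivAt hU h hp).sub (pT_hasDerivAt hU h' hp)
  rw [pT_eq hU h hp, pT_eq hU h' hp, ← h1.deriv]
  rfl

lemma pX_congr {U : Set (ℝ × ℝ)} (hU : IsOpen U) {φ ψ : ℝ × ℝ → ℝ}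
    (h : EqOn φ ψ U) {p : ℝ × ℝ} (hp : p ∈ U) : pX φ p = pX ψ p := by
  unfold pX
  apply Filter.EventuallyEq.deriv_eq
  have hc : Tendsto (fun x : ℝ => (x, p.2)) (𝓝 p.1) (𝓝 p) := by
    have : Continuous (fun x : ℝ => (x, p.2)) := by fun_prop
    simpa using this.tendsto p.1
  exact (hc.eventually (hU.mem_nhds hp)).mono fun x hx => h hx

lemma pXX_sub {U : Set (ℝ × ℝ)} (hU : IsOpen U) {φ ψ : ℝ × ℝ → ℝ}
    (h : ContDiffOn ℝ 2 φ U) (h' : ContDiffOn ℝ 2 ψ U) {p : ℝ × ℝ} (hp : p ∈ U) :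
    pXX (fun q => φ q - ψ q) p = pXX φ p - pXX ψ p := by
  have e : EqOn (pX (fun q => φ q - ψ q)) (fun q => pX φ q - pX ψ q) U := fun q hq =>
    pX_sub hU (h.of_le (by norm_num)) (h'.of_le (by norm_num)) hq
  have := pX_congr hU e hp
  exact this.trans (pX_sub hU (pX_contDiffOn hU h) (pX_contDiffOn hU h') hp)

/-- Second-order necessary condition. -/
lemma deriv2_nonpos {h : ℝ → ℝ} {x : ℝ} (hm : IsLocalMax h x) (hc : ContinuousAt h x) :
    deriv (deriv h) x ≤ 0 := by
  by_contra hcon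
  push Not at hcon
  have hmin := isLocalMin_of_deriv_deriv_pos hcon hm.deriv_eq_zero hc
  have heq : h =ᶠ[𝓝 x] fun _ => h x := by
    filter_upwards [hm, hmin] with y h1 h2 using le_antisymm h1 h2
  have h1 : deriv h =ᶠ[𝓝 x] fun _ => 0 := by
    have := heq.deriv
    simpa using this
  have := h1.deriv_eq
  simp at this
  linarith

lemma max_test {U : Set (ℝ × ℝ)} (hU : IsOpen U) {φ ψ : ℝ × ℝ → ℝ}
    (h : ContDiffOn ℝ 2 φ U) (h' : ContDiffOn ℝ 2 ψ U) {p : ℝ × ℝ} (hp : p ∈ U)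
    (hm : IsLocalMax (fun q => φ q - ψ q) p) :
    pT φ p = pT ψ p ∧ pX φ p = pX ψ p ∧ pXX φ p ≤ pXX ψ p := by
  have hcx : Tendsto (fun x : ℝ => (x, p.2)) (𝓝 p.1) (𝓝 p) := by
    have : Continuous (fun x : ℝ => (x, p.2)) := by fun_prop
    simpa using this.tendsto p.1
  have hct : Tendsto (fun x : ℝ => (p.1, x)) (𝓝 p.2) (𝓝 p) := by
    have : Continuous (fun x : ℝ => (p.1, x)) := by fun_prop
    simpa using this.tendsto p.2
  have mx : IsLocalMax (fun x => φ (x, p.2) - ψ (x, p.2)) p.1 := hcx.eventually hm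
  have mt : IsLocalMax (fun t => φ (p.1, t) - ψ (p.1, t)) p.2 := hct.eventually hm
  have l1 := h.of_le (m := 1) (by norm_num)
  have l2 := h'.of_le (m := 1) (by norm_num)
  have ex := pX_sub hU l1 l2 hp
  have et := pT_sub hU l1 l2 hp
  have exx := pXX_sub hU h h' hp
  have zx : pX (fun q => φ q - ψ q) p = 0 := mx.deriv_eq_zero
  have zt : pT (fun q => φ q - ψ q) p = 0 := mt.deriv_eq_zero
  have hc : ContinuousAt (fun x => φ (x, p.2) - ψ (x, p.2)) p.1 :=
    ((pX_hasDerivAt hU l1 hp).sub (pX_hasDerivAt hU l2 hp)).continuousAt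
  have zxx : pXX (fun q => φ q - ψ q) p ≤ 0 := deriv2_nonpos mx hc
  refine ⟨by linarith, by linarith, by linarith⟩

/-- The quartic penalisation, shifted by a constant. -/
def pen (p : ℝ × ℝ) (d : ℝ) (q : ℝ × ℝ) : ℝ := (q.1 - p.1) ^ 4 + (q.2 - p.2) ^ 4 + d

lemma pen_contDiff (p : ℝ × ℝ) (d : ℝ) : ContDiff ℝ 2 (pen p d) := by
  unfold pen; fun_prop

lemma pen_self (p : ℝ × ℝ) (d : ℝ) : pen p d p = d := by simp [pen]

lemma pen_nonneg (p : ℝ × ℝ) (d : ℝ) (q : ℝ × ℝ) : d ≤ pen p d q := by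
  have e1 : 0 ≤ (q.1 - p.1) ^ 4 := by positivity
  have e2 : 0 ≤ (q.2 - p.2) ^ 4 := by positivity
  unfold pen; linarith

lemma pen_ge {p q : ℝ × ℝ} (d : ℝ) {r : ℝ} (hr : 0 ≤ r) (h : r ≤ dist q p) :
    r ^ 4 + d ≤ pen p d q := by
  rw [Prod.dist_eq, le_max_iff, Real.dist_eq, Real.dist_eq] at h
  unfold pen
  have e1 : 0 ≤ (q.1 - p.1) ^ 4 := by positivity
  have e2 : 0 ≤ (q.2 - p.2) ^ 4 := by positivity
  rcases h with h | h
  · have := pow_le_pow_left₀ hr h 4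
    rw [Even.pow_abs (by decide)] at this
    linarith
  · have := pow_le_pow_left₀ hr h 4
    rw [Even.pow_abs (by decide)] at this
    linarith

lemma pX_pen (p : ℝ × ℝ) (d : ℝ) (q : ℝ × ℝ) : pX (pen p d) q = 4 * (q.1 - p.1) ^ 3 := by
  have h : HasDerivAt (fun x => pen p d (x, q.2)) (4 * (q.1 - p.1) ^ 3) q.1 := by
    unfold pen
    have := ((((hasDerivAt_id' q.1).sub_const p.1).pow 4).add_const ((q.2 - p.2) ^ 4)).add_const d
    refine this.congr_deriv ?_
    norm_num
  exact h.deriv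

lemma pT_pen_self (p : ℝ × ℝ) (d : ℝ) : pT (pen p d) p = 0 := by
  have h : HasDerivAt (fun t => pen p d (p.1, t)) 0 p.2 := by
    unfold pen
    have := ((((hasDerivAt_id' p.2).sub_const p.2).pow 4).const_add ((p.1 - p.1) ^ 4)).add_const d
    refine this.congr_deriv ?_
    norm_num
  exact h.deriv

lemma pXX_pen_self (p : ℝ × ℝ) (d : ℝ) : pXX (pen p d) p = 0 := by
  have h : HasDerivAt (fun x => pX (pen p d) (x, p.2)) 0 p.1 := by
    simp only [pX_pen]
    have := (((hasDerivAt_id' p.1).sub_const p.1).pow 3).const_mul 4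
    refine this.congr_deriv ?_
    norm_num
  exact h.deriv

lemma sub_pen {U : Set (ℝ × ℝ)} (hU : IsOpen U) {φ : ℝ × ℝ → ℝ}
    (h : ContDiffOn ℝ 2 φ U) {p : ℝ × ℝ} (hp : p ∈ U) (d : ℝ) :
    pT (fun q => φ q - pen p d q) p = pT φ p ∧ pX (fun q => φ q - pen p d q) p = pX φ p ∧
    pXX (fun q => φ q - pen p d q) p = pXX φ p := by
  have l1 := h.of_le (m := 1) (by norm_num)
  have h2 := (pen_contDiff p d).contDiffOn (s := U)
  have l2 := h2.of_le (m := 1) (by norm_num)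
  rw [pT_sub hU l1 l2 hp, pX_sub hU l1 l2 hp, pXX_sub hU h h2 hp, pT_pen_self, pX_pen,
    pXX_pen_self]
  norm_num

lemma add_pen {U : Set (ℝ × ℝ)} (hU : IsOpen U) {φ : ℝ × ℝ → ℝ}
    (h : ContDiffOn ℝ 2 φ U) {p : ℝ × ℝ} (hp : p ∈ U) (d : ℝ) :
    pT (fun q => φ q + pen p d q) p = pT φ p ∧ pX (fun q => φ q + pen p d q) p = pX φ p ∧
    pXX (fun q => φ q + pen p d q) p = pXX φ p := by
  have h2 := (pen_contDiff p d).contDiffOn (s := U)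
  have := sub_pen hU (h.add h2) hp d
  simp only [add_sub_cancel_right] at this
  exact ⟨this.1.symm, this.2.1.symm, this.2.2.symm⟩

/-! ### Envelopes -/

section env
variable {b : ℝ} {u : ℝ × ℝ → ℝ} {A B : ℝ × ℝ → ℝ} {p : ℝ × ℝ}

lemma env_bdd (hB : ContinuousOn B (Q0set b)) (h : ∀ q ∈ Q0set b, u q ≤ B q)
    (hp : p ∈ Q0set b) : IsBoundedUnder (· ≤ ·) (𝓝[Q0set b] p) u := by
  refine ⟨B p + 1, ?_⟩
  have h1 := (hB p hp).eventually (Iio_mem_nhds (lt_add_one (B p)))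
  rw [eventually_map]
  filter_upwards [h1, self_mem_nhdsWithin] with q h2 h3
  exact (h q h3).trans (le_of_lt h2)

lemma env_bdd' (hA : ContinuousOn A (Q0set b)) (h : ∀ q ∈ Q0set b, A q ≤ u q)
    (hp : p ∈ Q0set b) : IsBoundedUnder (· ≥ ·) (𝓝[Q0set b] p) u := by
  refine ⟨A p - 1, ?_⟩
  have h1 := (hA p hp).eventually (Ioi_mem_nhds (sub_one_lt (A p)))
  rw [eventually_map]
  filter_upwards [h1, self_mem_nhdsWithin] with q h2 h3
  exact (le_of_lt h2).trans (h q h3)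

lemma usc_lt (hB : ContinuousOn B (Q0set b)) (h : ∀ q ∈ Q0set b, u q ≤ B q)
    (hp : p ∈ Q0set b) {a : ℝ} (ha : uscEnv b u p < a) : ∀ᶠ q in 𝓝[Q0set b] p, u q < a :=
  eventually_lt_of_limsup_lt ha (env_bdd hB h hp)

lemma lt_lsc (hA : ContinuousOn A (Q0set b)) (h : ∀ q ∈ Q0set b, A q ≤ u q)
    (hp : p ∈ Q0set b) {a : ℝ} (ha : a < lscEnv b u p) : ∀ᶠ q in 𝓝[Q0set b] p, a < u q :=
  eventually_lt_of_lt_liminf ha (env_bdd' hA h hp)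

lemma lt_usc (hA : ContinuousOn A (Q0set b)) (h : ∀ q ∈ Q0set b, A q ≤ u q)
    (hp : p ∈ Q0set b) {a : ℝ} (ha : a < uscEnv b u p) : ∃ᶠ q in 𝓝[Q0set b] p, a < u q := by
  have := nhdsWithin_neBot_of_mem hp
  exact frequently_lt_of_lt_limsup (env_bdd' hA h hp).isCoboundedUnder_flip ha

lemma lsc_lt (hB : ContinuousOn B (Q0set b)) (h : ∀ q ∈ Q0set b, u q ≤ B q)
    (hp : p ∈ Q0set b) {a : ℝ} (ha : lscEnv b u p < a) : ∃ᶠ q in 𝓝[Q0set b] p, u q < a := by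
  have := nhdsWithin_neBot_of_mem hp
  exact frequently_lt_of_liminf_lt (env_bdd hB h hp).isCoboundedUnder_flip ha

lemma le_usc (hB : ContinuousOn B (Q0set b)) (h : ∀ q ∈ Q0set b, u q ≤ B q)
    (hp : p ∈ Q0set b) : u p ≤ uscEnv b u p := by
  by_contra hc
  push Not at hc
  exact lt_irrefl _ ((usc_lt hB h hp hc).self_of_nhdsWithin hp)

lemma lsc_le (hA : ContinuousOn A (Q0set b)) (h : ∀ q ∈ Q0set b, A q ≤ u q)
    (hp : p ∈ Q0set b) : lscEnv b u p ≤ u p := by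
  by_contra hc
  push Not at hc
  exact lt_irrefl _ ((lt_lsc hA h hp hc).self_of_nhdsWithin hp)

lemma usc_le {B' : ℝ × ℝ → ℝ} (hA : ContinuousOn A (Q0set b)) (h : ∀ q ∈ Q0set b, A q ≤ u q)
    (hB : ContinuousOn B' (Q0set b)) (hu : ∀ q ∈ Q0set b, u q ≤ B' q)
    (hp : p ∈ Q0set b) : uscEnv b u p ≤ B' p := by
  by_contra hc
  push Not at hc
  obtain ⟨a, ha1, ha2⟩ := exists_between hc
  have h1 := (hB p hp).eventually (Iio_mem_nhds ha1)
  obtain ⟨q, hq1, hq2, hq3⟩ :=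
    ((lt_usc hA h hp ha2).and_eventually (h1.and self_mem_nhdsWithin)).exists
  have := hu q hq3
  linarith

lemma le_lsc {A' : ℝ × ℝ → ℝ} (hB : ContinuousOn B (Q0set b)) (h : ∀ q ∈ Q0set b, u q ≤ B q)
    (hA : ContinuousOn A' (Q0set b)) (hu : ∀ q ∈ Q0set b, A' q ≤ u q)
    (hp : p ∈ Q0set b) : A' p ≤ lscEnv b u p := by
  by_contra hc
  push Not at hc
  obtain ⟨a, ha1, ha2⟩ := exists_between hc
  have h1 := (hA p hp).eventually (Ioi_mem_nhds ha2)
  obtain ⟨q, hq1, hq2, hq3⟩ :=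
    ((lsc_lt hB h hp ha1).and_eventually (h1.and self_mem_nhdsWithin)).exists
  have := hu q hq3
  linarith

lemma usc_usc (hA : ContinuousOn A (Q0set b)) (hAu : ∀ q ∈ Q0set b, A q ≤ u q)
    (hB : ContinuousOn B (Q0set b)) (h : ∀ q ∈ Q0set b, u q ≤ B q) :
    UpperSemicontinuousOn (uscEnv b u) (Q0set b) := by
  intro p hp a ha
  obtain ⟨c, hc1, hc2⟩ := exists_between ha
  have h1 := usc_lt hB h hp hc1
  rw [← eventually_eventually_nhdsWithin] at h1
  filter_upwards [h1, self_mem_nhdsWithin] with q hq1 hq2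
  refine lt_of_not_ge fun hcon => ?_
  obtain ⟨y, hy1, hy2⟩ :=
    ((lt_usc hA hAu hq2 (lt_of_lt_of_le hc2 hcon)).and_eventually hq1).exists
  exact lt_asymm hy1 hy2

lemma lsc_lsc (hA : ContinuousOn A (Q0set b)) (hAu : ∀ q ∈ Q0set b, A q ≤ u q)
    (hB : ContinuousOn B (Q0set b)) (h : ∀ q ∈ Q0set b, u q ≤ B q) :
    LowerSemicontinuousOn (lscEnv b u) (Q0set b) := by
  intro p hp a ha
  obtain ⟨c, hc1, hc2⟩ := exists_between ha
  have h1 := lt_lsc hA hAu hp hc2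
  rw [← eventually_eventually_nhdsWithin] at h1
  filter_upwards [h1, self_mem_nhdsWithin] with q hq1 hq2
  refine lt_of_not_ge fun hcon => ?_
  obtain ⟨y, hy1, hy2⟩ :=
    ((lsc_lt hB h hq2 (lt_of_le_of_lt hcon hc1)).and_eventually hq1).exists
  exact lt_asymm hy1 hy2

end env

/-! ### The Perron method -/

/-- Smooth strict super-solutions above the initial datum. -/
def UpperB (b : ℝ) (f g u0 : ℝ → ℝ) : Set (ℝ × ℝ → ℝ) :=
  {Φ | ContDiffOn ℝ 2 Φ (Qset b) ∧ ContinuousOn Φ (Q0set b) ∧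
    (∀ q ∈ Qset b, f (g (pX Φ q) * pXX Φ q) < pT Φ q) ∧ ∀ q ∈ Q0set b, u0 q.1 ≤ Φ q}

/-- The Perron class. -/
def PClass (b : ℝ) (f g u0 : ℝ → ℝ) : Set (ℝ × ℝ → ℝ) :=
  {v | IsSubSol b f g v ∧ ∀ Φ ∈ UpperB b f g u0, ∀ q ∈ Q0set b, v q ≤ Φ q}

/-- The Perron solution. -/
def PSup (b : ℝ) (f g u0 : ℝ → ℝ) (q : ℝ × ℝ) : ℝ :=
  sSup ((fun v : ℝ × ℝ → ℝ => v q) '' PClass b f g u0)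

section perron
variable {b : ℝ} {f g u0 : ℝ → ℝ} {A Φ : ℝ × ℝ → ℝ}

lemma op_continuousOn (hf : Continuous f) (hg : Continuous g) {φ : ℝ × ℝ → ℝ}
    (h : ContDiffOn ℝ 2 φ (Qset b)) :
    ContinuousOn (fun q => pT φ q - f (g (pX φ q) * pXX φ q)) (Qset b) := by
  have l1 := h.of_le (m := 1) (by norm_num)
  have hU := isOpen_Qset b
  have c1 := pT_continuousOn hU l1
  have c2 := pX_continuousOn hU l1
  have c3 := pXX_continuousOn hU h
  exact c1.sub (hf.comp_continuousOn ((hg.comp_continuousOn c2).mul c3))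

lemma PSup_le (hA : A ∈ PClass b f g u0) (hΦ : Φ ∈ UpperB b f g u0) {q : ℝ × ℝ}
    (hq : q ∈ Q0set b) : PSup b f g u0 q ≤ Φ q := by
  refine csSup_le ⟨_, A, hA, rfl⟩ ?_
  rintro _ ⟨v, hv, rfl⟩
  exact hv.2 Φ hΦ q hq

lemma le_PSup (hΦ : Φ ∈ UpperB b f g u0) {v : ℝ × ℝ → ℝ} (hv : v ∈ PClass b f g u0)
    {q : ℝ × ℝ} (hq : q ∈ Q0set b) : v q ≤ PSup b f g u0 q := by
  refine le_csSup ⟨Φ q, ?_⟩ ⟨v, hv, rfl⟩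
  rintro _ ⟨v, hv, rfl⟩
  exact hv.2 Φ hΦ q hq

lemma exists_lt_of_lt_PSup (hA : A ∈ PClass b f g u0) {q : ℝ × ℝ} {a : ℝ}
    (h : a < PSup b f g u0 q) : ∃ v ∈ PClass b f g u0, a < v q := by
  obtain ⟨_, ⟨v, hv, rfl⟩, h2⟩ := exists_lt_of_lt_csSup (Set.Nonempty.image _ ⟨A, hA⟩) h
  exact ⟨v, hv, h2⟩

lemma usc_PSup_mem (hf : Continuous f) (hg : Continuous g)
    (hA : A ∈ PClass b f g u0) (hAc : ContinuousOn A (Q0set b)) (hΦ : Φ ∈ UpperB b f g u0) :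
    uscEnv b (PSup b f g u0) ∈ PClass b f g u0 := by
  set u := PSup b f g u0 with hu
  have hAu : ∀ q ∈ Q0set b, A q ≤ u q := fun q hq => le_PSup hΦ hA hq
  have huΦ : ∀ q ∈ Q0set b, u q ≤ Φ q := fun q hq => PSup_le hA hΦ hq
  refine ⟨⟨usc_usc hAc hAu hΦ.2.1 huΦ, ?_⟩, ?_⟩
  swap
  · intro Ψ hΨ q hq
    exact usc_le hAc hAu hΨ.2.1 (fun q hq => PSup_le hA hΨ hq) hq
  intro φ hφ p hp hmax
  by_contra hcon
  push Not at hcon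
  have hU := isOpen_Qset b
  -- the perturbed test function
  set φ' : ℝ × ℝ → ℝ := fun q => φ q + pen p 0 q with hφ'
  have hφ'C : ContDiffOn ℝ 2 φ' (Qset b) := hφ.add (pen_contDiff p 0).contDiffOn
  obtain ⟨e1, e2, e3⟩ := add_pen hU hφ hp 0
  have hpos : 0 < pT φ' p - f (g (pX φ' p) * pXX φ' p) := by
    rw [hφ', e1, e2, e3]; exact hcon
  have ev1 : ∀ᶠ q in 𝓝 p, 0 < pT φ' q - f (g (pX φ' q) * pXX φ' q) :=
    ((op_continuousOn hf hg hφ'C).continuousAt (hU.mem_nhds hp)).eventually (Ioi_mem_nhds hpos)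
  have ev2 : ∀ᶠ q in 𝓝 p, uscEnv b u q - φ q ≤ uscEnv b u p - φ p := by
    have : 𝓝[Qset b] p = 𝓝 p := hU.nhdsWithin_eq hp
    have h := hmax
    unfold IsLocalMaxOn IsMaxFilter at h
    rwa [this] at h
  obtain ⟨r, hr, hball⟩ := Metric.nhds_basis_closedBall.mem_iff.1
    (ev1.and (ev2.and (hU.mem_nhds hp)))
  -- a point near p where u is nearly u*
  have hp0 := Qset_sub b hp
  have hr4 : 0 < r ^ 4 := by positivity
  have hfr := lt_usc hAc hAu hp0 (show uscEnv b u p - r ^ 4 / 2 < uscEnv b u p by linarith)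
  have hcont : ContinuousAt φ' p := hφ'C.continuousOn.continuousAt (hU.mem_nhds hp)
  have hφp : φ' p = φ p := by simp [hφ', pen_self]
  have ev3 : ∀ᶠ q in 𝓝[Q0set b] p, φ' q < φ p + r ^ 4 / 2 := by
    apply mem_nhdsWithin_of_mem_nhds
    apply hcont.eventually (Iio_mem_nhds _)
    rw [hφp]; linarith
  have ev4 : ∀ᶠ q in 𝓝[Q0set b] p, q ∈ Metric.closedBall p r :=
    mem_nhdsWithin_of_mem_nhds (Metric.closedBall_mem_nhds p hr)
  obtain ⟨q, hq1, hq3, hq4⟩ := (hfr.and_eventually (ev3.and ev4)).exists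
  obtain ⟨v, hv, hvq⟩ := exists_lt_of_lt_PSup hA hq1
  have husc : UpperSemicontinuousOn (fun q => v q - φ' q) (Metric.closedBall p r) := by
    have h1 : UpperSemicontinuousOn v (Metric.closedBall p r) :=
      hv.1.1.mono fun y hy => Qset_sub b (hball hy).2.2
    have h2 : ContinuousOn (fun q => - φ' q) (Metric.closedBall p r) :=
      (hφ'C.continuousOn.mono fun y hy => (hball hy).2.2).neg
    simpa [sub_eq_add_neg] using h1.add h2.upperSemicontinuousOn
  obtain ⟨m, hm, hmmax⟩ := husc.exists_isMaxOn ⟨q, hq4⟩ (isCompact_closedBall p r)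
  have hmq : v q - φ' q ≤ v m - φ' m := hmmax hq4
  -- the maximum is interior
  have hmint : m ∈ Metric.ball p r := by
    rw [Metric.mem_ball]
    by_contra hge
    push Not at hge
    have h1 := pen_ge 0 hr.le hge
    have h2 : v m ≤ uscEnv b u m :=
      (le_PSup hΦ hv (Qset_sub b (hball hm).2.2)).trans
        (le_usc hΦ.2.1 huΦ (Qset_sub b (hball hm).2.2))
    have h3 := (hball hm).2.1
    have h4 : φ' m = φ m + pen p 0 m := rfl
    linarith
  have hloc : IsLocalMaxOn (fun q => v q - φ' q) (Qset b) m := by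
    apply mem_nhdsWithin_of_mem_nhds
    filter_upwards [Metric.isOpen_ball.mem_nhds hmint] with y hy
    exact hmmax (Metric.ball_subset_closedBall hy)
  have h1 := hv.1.2 φ' hφ'C m (hball hm).2.2 hloc
  have h2 := (hball hm).1
  linarith

lemma usc_PSup_eq (hf : Continuous f) (hg : Continuous g)
    (hA : A ∈ PClass b f g u0) (hAc : ContinuousOn A (Q0set b)) (hΦ : Φ ∈ UpperB b f g u0)
    {q : ℝ × ℝ} (hq : q ∈ Q0set b) : uscEnv b (PSup b f g u0) q = PSup b f g u0 q :=
  le_antisymm (le_PSup hΦ (usc_PSup_mem hf hg hA hAc hΦ) hq)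
    (le_usc hΦ.2.1 (fun q hq => PSup_le hA hΦ hq) hq)

/-- Smooth functions satisfying the differential inequality are viscosity sub-solutions. -/
lemma smooth_test (hfm : Monotone f) (hg0 : ∀ s, 0 < g s) {φ ψ : ℝ × ℝ → ℝ}
    (hφ : ContDiffOn ℝ 2 φ (Qset b)) (hψ : ContDiffOn ℝ 2 ψ (Qset b)) {p : ℝ × ℝ}
    (hp : p ∈ Qset b) (hm : IsLocalMax (fun q => φ q - ψ q) p)
    (h : pT φ p - f (g (pX φ p) * pXX φ p) ≤ 0) :
    pT ψ p - f (g (pX ψ p) * pXX ψ p) ≤ 0 := by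
  obtain ⟨h1, h2, h3⟩ := max_test (isOpen_Qset b) hφ hψ hp hm
  rw [← h1, ← h2]
  have := hfm (mul_le_mul_of_nonneg_left h3 (hg0 (pX φ p)).le)
  linarith

lemma lsc_PSup_super (hf : Continuous f) (hfm : Monotone f) (hg : Continuous g)
    (hg0 : ∀ s, 0 < g s)
    (hA : A ∈ PClass b f g u0) (hAc : ContinuousOn A (Q0set b)) (hΦ : Φ ∈ UpperB b f g u0)
    (φ : ℝ × ℝ → ℝ) (hφ : ContDiffOn ℝ 2 φ (Qset b)) (p : ℝ × ℝ) (hp : p ∈ Qset b)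
    (hmin : IsLocalMinOn (fun q => lscEnv b (PSup b f g u0) q - φ q) (Qset b) p) :
    0 ≤ pT φ p - f (g (pX φ p) * pXX φ p) := by
  by_contra hcon
  push Not at hcon
  have hU := isOpen_Qset b
  have hmem := usc_PSup_mem hf hg hA hAc hΦ
  have heq : ∀ q ∈ Q0set b, uscEnv b (PSup b f g u0) q = PSup b f g u0 q :=
    fun q hq => usc_PSup_eq hf hg hA hAc hΦ hq
  set u := PSup b f g u0 with hu
  set us := uscEnv b u with hus
  have hAu : ∀ q ∈ Q0set b, A q ≤ u q := fun q hq => le_PSup hΦ hA hq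
  have huΦ : ∀ q ∈ Q0set b, u q ≤ Φ q := fun q hq => PSup_le hA hΦ hq
  have hC : ∀ d, ContDiffOn ℝ 2 (fun q => φ q - pen p d q) (Qset b) := fun d =>
    hφ.sub (pen_contDiff p d).contDiffOn
  have ev1 : ∀ᶠ q in 𝓝 p, pT (fun q => φ q - pen p 0 q) q -
      f (g (pX (fun q => φ q - pen p 0 q) q) * pXX (fun q => φ q - pen p 0 q) q) < 0 := by
    obtain ⟨e1, e2, e3⟩ := sub_pen hU hφ hp 0
    refine ((op_continuousOn hf hg (hC 0)).continuousAt (hU.mem_nhds hp)).eventually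
      (Iio_mem_nhds ?_)
    simp only [e1, e2, e3]; exact hcon
  have ev2 : ∀ᶠ q in 𝓝 p, lscEnv b u p - φ p ≤ lscEnv b u q - φ q := by
    have : 𝓝[Qset b] p = 𝓝 p := hU.nhdsWithin_eq hp
    have h := hmin
    unfold IsLocalMinOn IsMinFilter at h
    rwa [this] at h
  obtain ⟨r, hr, hball⟩ := Metric.nhds_basis_closedBall.mem_iff.1
    (ev1.and (ev2.and (hU.mem_nhds hp)))
  have hp0 := Qset_sub b hp
  set δ : ℝ := (r / 2) ^ 4 / 2 with hδ
  have hδ0 : 0 < δ := by positivity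
  set d : ℝ := φ p - lscEnv b u p - δ with hd
  set ψ : ℝ × ℝ → ℝ := fun q => φ q - pen p d q with hψ
  have hψC : ContDiffOn ℝ 2 ψ (Qset b) := hC d
  have hψ0 : ψ = fun q => (φ q - pen p 0 q) - d := by
    funext q; simp only [hψ, pen]; ring
  have hψX : pX ψ = pX (fun q => φ q - pen p 0 q) := by
    funext q; simp only [hψ0, pX, deriv_sub_const_fun]
  have hψT : pT ψ = pT (fun q => φ q - pen p 0 q) := by
    funext q; simp only [hψ0, pT, deriv_sub_const_fun]
  have hψXX : pXX ψ = pXX (fun q => φ q - pen p 0 q) := by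
    funext q; simp only [pXX, hψX]
  have hstrict : ∀ q ∈ Metric.closedBall p r, pT ψ q - f (g (pX ψ q) * pXX ψ q) < 0 := by
    intro q hq
    rw [hψX, hψT, hψXX]; exact (hball hq).1
  have hlow : ∀ q ∈ Metric.closedBall p r, r / 2 ≤ dist q p → ψ q < us q := by
    intro q hq hdist
    have h1 := pen_ge d (by positivity) hdist
    have hq0 := Qset_sub b (hball hq).2.2
    have h2 := (hball hq).2.1
    have h3 : lscEnv b u q ≤ u q := lsc_le hAc hAu hq0
    rw [heq q hq0]
    have h4 : ψ q = φ q - pen p d q := rfl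
    linarith
  classical
  set w : ℝ × ℝ → ℝ := fun q => if q ∈ Metric.ball p r then max (us q) (ψ q) else us q with hw
  have hw1 : ∀ q, us q ≤ w q := by
    intro q; simp only [hw]; split_ifs
    · exact le_max_left _ _
    · exact le_rfl
  have hw2 : ∀ q ∈ Metric.ball p r, ψ q ≤ w q := by
    intro q hq; simp only [hw, if_pos hq]; exact le_max_right _ _
  have hw3 : ∀ q, r / 2 ≤ dist q p → w q = us q := by
    intro q hq; simp only [hw]; split_ifs with h
    · exact max_eq_left (hlow q (Metric.ball_subset_closedBall h) hq).le
    · rfl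
  have hsub : IsSubSol b f g w := by
    constructor
    · intro q hq a ha
      have ha1 : us q < a := (hw1 q).trans_lt ha
      have h1 := hmem.1.1 q hq a ha1
      by_cases hd : dist q p < r
      · have h2 : ∀ᶠ y in 𝓝[Q0set b] q, ψ y < a := by
          apply mem_nhdsWithin_of_mem_nhds
          exact (hψC.continuousOn.continuousAt (hU.mem_nhds (hball (le_of_lt hd)).2.2)).eventually
            (Iio_mem_nhds ((hw2 q hd).trans_lt ha))
        filter_upwards [h1, h2] with y hy1 hy2
        simp only [hw]; split_ifs
        · exact max_lt hy1 hy2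
        · exact hy1
      · have h2 : ∀ᶠ y in 𝓝[Q0set b] q, r / 2 < dist y p := by
          apply mem_nhdsWithin_of_mem_nhds
          have hc : Continuous fun y : ℝ × ℝ => dist y p := by fun_prop
          exact hc.continuousAt.eventually (Ioi_mem_nhds (by linarith))
        filter_upwards [h1, h2] with y hy1 hy2
        rw [hw3 y hy2.le]; exact hy1
    · intro ζ hζ q hq hloc
      by_cases hc : w q = us q
      · apply hmem.1.2 ζ hζ q hq
        filter_upwards [hloc] with y hy
        have := hw1 y
        linarith
      · have hqb : q ∈ Metric.ball p r := by
          by_contra h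
          exact hc (by simp only [hw, if_neg h])
        have hwq : w q = ψ q := by
          rcases max_choice (us q) (ψ q) with h | h
          · exact absurd (by simp only [hw, if_pos hqb, h]) hc
          · simp only [hw, if_pos hqb, h]
        have hl : IsLocalMax (fun y => ψ y - ζ y) q := by
          have h := hloc
          unfold IsLocalMaxOn IsMaxFilter at h
          rw [hU.nhdsWithin_eq hq] at h
          filter_upwards [h, Metric.isOpen_ball.mem_nhds hqb] with y hy hyb
          have := hw2 y hyb
          linarith
        exact smooth_test hfm hg0 hψC hζ hq hl
          (hstrict q (Metric.ball_subset_closedBall hqb)).le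
  have hwP : w ∈ PClass b f g u0 := by
    refine ⟨hsub, ?_⟩
    intro Ψ hΨ q0 hq0
    by_contra hcon2
    push Not at hcon2
    have hout : ∀ y ∈ Q0set b, y ∉ Metric.closedBall p (r / 2) → w y ≤ Ψ y := by
      intro y hy hyb
      rw [Metric.mem_closedBall, not_le] at hyb
      rw [hw3 y hyb.le]; exact hmem.2 Ψ hΨ y hy
    have hq0b : q0 ∈ Metric.closedBall p (r / 2) := by
      by_contra h
      exact absurd (hout q0 hq0 h) (not_le.2 hcon2)
    have hKQ : Metric.closedBall p (r / 2) ⊆ Qset b := fun y hy =>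
      (hball (Metric.closedBall_subset_closedBall (by linarith) hy)).2.2
    have husc : UpperSemicontinuousOn (fun q => w q - Ψ q) (Metric.closedBall p (r / 2)) := by
      have h1 : UpperSemicontinuousOn w (Metric.closedBall p (r / 2)) :=
        hsub.1.mono (hKQ.trans (Qset_sub b))
      have h2 : ContinuousOn (fun q => - Ψ q) (Metric.closedBall p (r / 2)) :=
        (hΨ.2.1.mono (hKQ.trans (Qset_sub b))).neg
      simpa [sub_eq_add_neg] using h1.add h2.upperSemicontinuousOn
    obtain ⟨m, hm, hmmax⟩ := husc.exists_isMaxOn ⟨q0, hq0b⟩ (isCompact_closedBall p (r / 2))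
    have hpos : w q0 - Ψ q0 ≤ w m - Ψ m := hmmax hq0b
    have hloc : IsLocalMaxOn (fun q => w q - Ψ q) (Qset b) m := by
      filter_upwards [self_mem_nhdsWithin] with y hy
      by_cases hyb : y ∈ Metric.closedBall p (r / 2)
      · exact hmmax hyb
      · have := hout y (Qset_sub b hy) hyb
        linarith
    have h1 := hsub.2 Ψ hΨ.1 m (hKQ hm) hloc
    have h2 := hΨ.2.2.1 m (hKQ hm)
    linarith
  -- contradiction near `p`
  have hfr := lsc_lt hΦ.2.1 huΦ hp0
    (show lscEnv b u p < lscEnv b u p + δ / 2 by linarith)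
  have hψp : ψ p = lscEnv b u p + δ := by
    simp only [hψ, pen_self, hd]; ring
  have ev3 : ∀ᶠ q in 𝓝[Q0set b] p, lscEnv b u p + δ / 2 < ψ q := by
    apply mem_nhdsWithin_of_mem_nhds
    apply (hψC.continuousOn.continuousAt (hU.mem_nhds hp)).eventually (Ioi_mem_nhds _)
    rw [hψp]; linarith
  have ev4 : ∀ᶠ q in 𝓝[Q0set b] p, q ∈ Metric.ball p r :=
    mem_nhdsWithin_of_mem_nhds (Metric.ball_mem_nhds p hr)
  obtain ⟨q, hq1, hq2, hq3, hq4⟩ :=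
    (hfr.and_eventually (ev3.and (ev4.and self_mem_nhdsWithin))).exists
  have h1 := le_PSup hΦ hwP hq4
  have h2 := hw2 q hq3
  linarith

end perron

/-! ### Barriers -/

lemma bdd_of_ends {b : ℝ} {G : ℝ → ℝ} (hG : ContinuousOn G (Ioo (-b) b))
    (hb : 0 < b) (h1 : ∃ C, ∀ᶠ x in 𝓝[<] b, G x ≤ C) (h2 : ∃ C, ∀ᶠ x in 𝓝[>] (-b), G x ≤ C) :
    ∃ C, ∀ x ∈ Ioo (-b) b, G x ≤ C := by
  obtain ⟨C1, h1⟩ := h1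
  obtain ⟨C2, h2⟩ := h2
  obtain ⟨l, hl, hl2⟩ := (mem_nhdsLT_iff_exists_Ioo_subset' (show -b < b by linarith)).1 h1
  obtain ⟨k, hk, hk2⟩ := (mem_nhdsGT_iff_exists_Ioo_subset' (show -b < b by linarith)).1 h2
  simp only [mem_Iio, mem_Ioi] at hl hk
  have hsub : Icc k l ⊆ Ioo (-b) b := fun x hx => ⟨hk.trans_le hx.1, hx.2.trans_lt hl⟩
  obtain ⟨C3, hC3⟩ := (isCompact_Icc (a := k) (b := l)).bddAbove_image (hG.mono hsub)
  refine ⟨max (max C1 C2) C3, fun x hx => ?_⟩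
  by_cases c1 : l < x
  · exact (hl2 ⟨c1, hx.2⟩ : G x ≤ C1).trans ((le_max_left _ _).trans (le_max_left _ _))
  by_cases c2 : x < k
  · exact (hk2 ⟨hx.1, c2⟩ : G x ≤ C2).trans ((le_max_right _ _).trans (le_max_left _ _))
  · push Not at c1 c2
    exact (hC3 ⟨x, ⟨c2, c1⟩, rfl⟩).trans (le_max_right _ _)

lemma g_bound {g : ℝ → ℝ} {α : ℝ} (hα : 2 < α) (hg : A2 g α) :
    ∃ C, 0 ≤ C ∧ ∀ s, (1 + s ^ 2) * g s ≤ C := by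
  obtain ⟨hc, h0, Cp, Cm, hCp, hCm, h1, h2⟩ := hg
  have key : ∀ s C : ℝ, 1 ≤ |s| → |s| ^ α * g s ≤ C → (1 + s ^ 2) * g s ≤ 2 * C := by
    intro s C hs h
    have e1 : s ^ 2 ≤ |s| ^ α := by
      have := Real.rpow_le_rpow_of_exponent_le hs hα.le
      rwa [Real.rpow_two, sq_abs] at this
    have e2 : 1 ≤ s ^ 2 := by rw [← sq_abs]; nlinarith
    have e3 := mul_le_mul_of_nonneg_right e1 (h0 s).le
    have e4 := mul_le_mul_of_nonneg_right e2 (h0 s).le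
    nlinarith
  have a1 := (h1.eventually (Iic_mem_nhds (lt_add_one Cp))).and (eventually_ge_atTop 1)
  have a2 := (h2.eventually (Iic_mem_nhds (lt_add_one Cm))).and (eventually_le_atBot (-1))
  obtain ⟨R1, hR1⟩ := eventually_atTop.1 a1
  obtain ⟨R2, hR2⟩ := eventually_atBot.1 a2
  obtain ⟨C3, hC3⟩ := (isCompact_Icc (a := R2) (b := R1)).bddAbove_image
    (f := fun s => (1 + s ^ 2) * g s) (by fun_prop)
  refine ⟨max (max (2 * (Cp + 1)) (2 * (Cm + 1))) C3, ?_, fun s => ?_⟩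
  · refine le_trans ?_ ((le_max_left _ _).trans (le_max_left _ _))
    linarith
  by_cases c1 : R1 < s
  · have := hR1 s c1.le
    exact (key s _ (this.2.trans (le_abs_self s)) this.1).trans
      ((le_max_left _ _).trans (le_max_left _ _))
  by_cases c2 : s < R2
  · have := hR2 s c2.le
    exact (key s _ (by rw [le_abs]; right; linarith [this.2]) this.1).trans
      ((le_max_right _ _).trans (le_max_left _ _))
  · push Not at c1 c2
    exact (hC3 ⟨s, ⟨c2, c1⟩, rfl⟩).trans (le_max_right _ _)

lemma u0_bound {b : ℝ} {u0 : ℝ → ℝ} (hb : 0 < b) (h : B2 b u0) :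
    ∃ n : ℕ, 1 ≤ n ∧ ∃ C, ∀ x ∈ Ioo (-b) b, u0 x * (b ^ 2 - x ^ 2) ^ n ≤ C := by
  obtain ⟨hc, t1, t2, γ, hγ, ⟨C1, h1⟩, ⟨C2, h2⟩⟩ := h
  have hγn : γ ≤ (⌈γ⌉₊ : ℝ) := Nat.le_ceil γ
  refine ⟨⌈γ⌉₊, Nat.one_le_iff_ne_zero.2 (Nat.ceil_pos.2 hγ).ne', ?_⟩
  set n := ⌈γ⌉₊
  have key : ∀ y z v C : ℝ, 0 < y → y < 1 → 0 < z → z < 2 * b → 0 < v → v * y ^ γ ≤ C →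
      v * (y * z) ^ n ≤ C * (2 * b) ^ n := by
    intro y z v C hy hy1 hz hz2 hv h
    have e1 : y ^ n ≤ y ^ γ := by
      have := Real.rpow_le_rpow_of_exponent_ge hy hy1.le hγn
      rwa [Real.rpow_natCast] at this
    have e2 : z ^ n ≤ (2 * b) ^ n := pow_le_pow_left₀ hz.le hz2.le n
    rw [mul_pow, ← mul_assoc]
    have e3 : v * y ^ n ≤ C := (mul_le_mul_of_nonneg_left e1 hv.le).trans h
    have e4 : 0 ≤ v * y ^ n := by positivity
    exact mul_le_mul e3 e2 (by positivity) (e4.trans e3)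
  refine bdd_of_ends (by fun_prop) hb ⟨C1 * (2 * b) ^ n, ?_⟩ ⟨C2 * (2 * b) ^ n, ?_⟩
  · have m1 : ∀ᶠ x in 𝓝[<] b, x ∈ Ioo (max (-b) (b - 1)) b :=
      Ioo_mem_nhdsLT (max_lt (by linarith) (by linarith))
    filter_upwards [h1, m1, t1.eventually_gt_atTop 0] with x hx ⟨hx1, hx2⟩ hx3
    have l1 := (le_max_left _ _).trans_lt hx1
    have l2 := (le_max_right _ _).trans_lt hx1
    have := key (b - x) (b + x) (u0 x) C1 (by linarith) (by linarith) (by linarith)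
      (by linarith) hx3 hx
    rwa [show b ^ 2 - x ^ 2 = (b - x) * (b + x) by ring]
  · have m1 : ∀ᶠ x in 𝓝[>] (-b), x ∈ Ioo (-b) (min b (-b + 1)) :=
      Ioo_mem_nhdsGT (lt_min (by linarith) (by linarith))
    filter_upwards [h2, m1, t2.eventually_gt_atTop 0] with x hx ⟨hx1, hx2⟩ hx3
    have l1 := hx2.trans_le (min_le_left _ _)
    have l2 := hx2.trans_le (min_le_right _ _)
    have := key (b + x) (b - x) (u0 x) C2 (by linarith) (by linarith) (by linarith)
      (by linarith) hx3 hx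
    rwa [show b ^ 2 - x ^ 2 = (b + x) * (b - x) by ring]

lemma u0_lower {b : ℝ} {u0 : ℝ → ℝ} (hb : 0 < b) (h : B2 b u0) :
    ∃ m, ∀ x ∈ Ioo (-b) b, -m ≤ u0 x := by
  obtain ⟨C, hC⟩ := bdd_of_ends (G := fun x => - u0 x) h.1.neg hb
    ⟨0, by filter_upwards [h.2.1.eventually_ge_atTop 0] with x hx; linarith⟩
    ⟨0, by filter_upwards [h.2.2.1.eventually_ge_atTop 0] with x hx; linarith⟩
  exact ⟨C, fun x hx => by linarith [hC x hx]⟩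

/-- The singular profile. -/
def prof (b x0 K : ℝ) (n : ℕ) (x : ℝ) : ℝ := K * (x - x0) ^ 2 * ((b ^ 2 - x ^ 2)⁻¹) ^ n

lemma D_pos {b x : ℝ} (hx : x ∈ Ioo (-b) b) : 0 < b ^ 2 - x ^ 2 := by
  nlinarith [hx.1, hx.2]

lemma inv_pow_hasDerivAt {b x : ℝ} (hx : x ∈ Ioo (-b) b) (n : ℕ) :
    HasDerivAt (fun y => ((b ^ 2 - y ^ 2)⁻¹) ^ n)
      (2 * n * x * ((b ^ 2 - x ^ 2)⁻¹) ^ (n + 1)) x := by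
  have hD := (D_pos hx).ne'
  have h1 : HasDerivAt (fun y => b ^ 2 - y ^ 2) (-(2 * x)) x := by
    refine (((hasDerivAt_id' x).pow 2).const_sub (b ^ 2)).congr_deriv ?_
    norm_num
  have h2 := (h1.inv hD).pow n
  refine h2.congr_deriv ?_
  cases n with
  | zero => simp
  | succ m =>
    simp only [Nat.add_sub_cancel, Pi.inv_apply]
    push_cast
    simp only [pow_succ]
    field_simp

lemma prof_deriv {b x0 K x : ℝ} {n : ℕ} (hx : x ∈ Ioo (-b) b) :
    HasDerivAt (prof b x0 K n) (K * (2 * (x - x0)) * ((b ^ 2 - x ^ 2)⁻¹) ^ n +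
      K * (x - x0) ^ 2 * (2 * n * x * ((b ^ 2 - x ^ 2)⁻¹) ^ (n + 1))) x := by
  have h1 : HasDerivAt (fun y => K * (y - x0) ^ 2) (K * (2 * (x - x0))) x := by
    refine ((((hasDerivAt_id' x).sub_const x0).pow 2).const_mul K).congr_deriv ?_
    norm_num
  exact h1.mul (inv_pow_hasDerivAt hx n)

lemma prof_deriv2 {b x0 K x : ℝ} {n : ℕ} (hx : x ∈ Ioo (-b) b) :
    deriv (deriv (prof b x0 K n)) x = K * 2 * ((b ^ 2 - x ^ 2)⁻¹) ^ n +
      K * (2 * (x - x0)) * (2 * n * x * ((b ^ 2 - x ^ 2)⁻¹) ^ (n + 1)) +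
      (K * (2 * (x - x0)) * (2 * n * x * ((b ^ 2 - x ^ 2)⁻¹) ^ (n + 1)) +
        K * (x - x0) ^ 2 * (2 * n * ((b ^ 2 - x ^ 2)⁻¹) ^ (n + 1) +
          2 * n * x * (2 * (n + 1 : ℕ) * x * ((b ^ 2 - x ^ 2)⁻¹) ^ (n + 1 + 1)))) := by
  have e : deriv (prof b x0 K n) =ᶠ[𝓝 x] fun x =>
      K * (2 * (x - x0)) * ((b ^ 2 - x ^ 2)⁻¹) ^ n +
      K * (x - x0) ^ 2 * (2 * n * x * ((b ^ 2 - x ^ 2)⁻¹) ^ (n + 1)) := by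
    filter_upwards [isOpen_Ioo.mem_nhds hx] with y hy using (prof_deriv hy).deriv
  rw [e.deriv_eq]
  have h0 : HasDerivAt (fun y => K * (2 * (y - x0))) (K * 2) x := by
    refine ((((hasDerivAt_id' x).sub_const x0).const_mul 2).const_mul K).congr_deriv ?_
    norm_num
  have h1 : HasDerivAt (fun y => K * (y - x0) ^ 2) (K * (2 * (x - x0))) x := by
    refine ((((hasDerivAt_id' x).sub_const x0).pow 2).const_mul K).congr_deriv ?_
    norm_num
  have h2 : HasDerivAt (fun y => 2 * (n : ℝ) * y) (2 * n) x := by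
    simpa using (hasDerivAt_id' x).const_mul (2 * (n : ℝ))
  exact ((h0.mul (inv_pow_hasDerivAt hx n)).add
    (h1.mul (h2.mul (inv_pow_hasDerivAt hx (n + 1))))).deriv

lemma prof_bound {b x0 K : ℝ} {n : ℕ} (hn : 1 ≤ n) (hK : 0 < K) (hb : 0 < b)
    (hx0 : x0 ∈ Ioo (-b) b) :
    ∃ C, 0 ≤ C ∧ ∀ x ∈ Ioo (-b) b,
      deriv (deriv (prof b x0 K n)) x ≤ C * (1 + (deriv (prof b x0 K n) x) ^ 2) := by
  set P : ℝ → ℝ := fun x => (b ^ 2 - x ^ 2) ^ (2 * n + 2) +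
    K ^ 2 * (2 * (x - x0) * (b ^ 2 - x ^ 2) + 2 * n * x * (x - x0) ^ 2) ^ 2 with hP
  set N : ℝ → ℝ := fun x => K * (2 * (b ^ 2 - x ^ 2) ^ 2 +
    8 * n * x * (x - x0) * (b ^ 2 - x ^ 2) + 2 * n * (x - x0) ^ 2 * (b ^ 2 - x ^ 2) +
    4 * n * (n + 1) * x ^ 2 * (x - x0) ^ 2) * (b ^ 2 - x ^ 2) ^ n with hN
  have hPpos : ∀ x ∈ Icc (-b) b, 0 < P x := by
    intro x hx
    by_cases hxo : x ∈ Ioo (-b) b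
    · have := D_pos hxo
      simp only [hP]
      positivity
    · have hxb : x = b ∨ x = -b := by
        by_contra hcon
        push Not at hcon
        exact hxo ⟨lt_of_le_of_ne hx.1 hcon.2.symm, lt_of_le_of_ne hx.2 hcon.1⟩
      have hD : b ^ 2 - x ^ 2 = 0 := by rcases hxb with h | h <;> rw [h] <;> ring
      have hx1 : x ≠ 0 := by rcases hxb with h | h <;> rw [h] <;> simp [hb.ne']
      have hx2 : x - x0 ≠ 0 := by
        intro h
        apply hxo
        rw [show x = x0 by linarith]; exact hx0
      have hn0 : (n : ℝ) ≠ 0 := by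
        have : n ≠ 0 := by omega
        exact_mod_cast this
      simp only [hP, hD]
      have : 0 < (2 * n * x * (x - x0) ^ 2) ^ 2 := by positivity
      have hK2 : 0 < K ^ 2 := by positivity
      simp only [mul_zero, zero_add]
      positivity
  have hcont : ContinuousOn (fun x => N x / P x) (Icc (-b) b) := by
    apply ContinuousOn.div
    · simp only [hN]; fun_prop
    · simp only [hP]; fun_prop
    · exact fun x hx => (hPpos x hx).ne'
  obtain ⟨C, hC⟩ := (isCompact_Icc (a := -b) (b := b)).bddAbove_image hcont
  refine ⟨max C 0, le_max_right _ _, fun x hx => ?_⟩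
  have hD := D_pos hx
  have hle : N x / P x ≤ max C 0 := (hC ⟨x, Ioo_subset_Icc_self hx, rfl⟩).trans (le_max_left _ _)
  rw [div_le_iff₀ (hPpos x (Ioo_subset_Icc_self hx))] at hle
  have e1 : deriv (deriv (prof b x0 K n)) x * (b ^ 2 - x ^ 2) ^ (2 * n + 2) = N x := by
    rw [prof_deriv2 hx]
    simp only [hN]
    push_cast
    set E := b ^ 2 - x ^ 2
    have hE : E ≠ 0 := hD.ne'
    rw [show 2 * n + 2 = n + 2 + n by ring, pow_add E (n + 2) n, pow_add E n 2,
      inv_pow, inv_pow, inv_pow, pow_succ E (n + 1), pow_succ E n]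
    field_simp
    ring
  have e2 : (1 + (deriv (prof b x0 K n) x) ^ 2) * (b ^ 2 - x ^ 2) ^ (2 * n + 2) = P x := by
    rw [(prof_deriv hx).deriv]
    simp only [hP]
    set E := b ^ 2 - x ^ 2
    have hE : E ≠ 0 := hD.ne'
    rw [show 2 * n + 2 = (n + 1) * 2 by ring, pow_mul, inv_pow, inv_pow, pow_succ E n]
    field_simp
  have hpos : 0 < (b ^ 2 - x ^ 2) ^ (2 * n + 2) := by positivity
  rw [← mul_le_mul_iff_left₀ hpos, mul_assoc, e1, e2]
  exact hle

lemma exists_upper {b α : ℝ} {f g u0 : ℝ → ℝ} (hb : 0 < b) (hf : A1 f) (hα : 2 < α)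
    (hg : A2 g α) (hu0 : B2 b u0) {x0 ε : ℝ} (hx0 : x0 ∈ Ioo (-b) b) (hε : 0 < ε) :
    ∃ Φ ∈ UpperB b f g u0, Φ (x0, 0) = u0 x0 + ε := by
  obtain ⟨n, hn, C, hC⟩ := u0_bound hb hu0
  -- choice of `K`
  have hloc : ∀ᶠ x in 𝓝 x0, u0 x < u0 x0 + ε :=
    (hu0.1.continuousAt (isOpen_Ioo.mem_nhds hx0)).eventually (Iio_mem_nhds (by linarith))
  obtain ⟨δ, hδ, hball⟩ := Metric.eventually_nhds_iff.1 hloc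
  set C' : ℝ := |C| + |u0 x0| * (b ^ 2) ^ n with hC'
  set K : ℝ := C' / δ ^ 2 + 1 with hK
  have hC'0 : 0 ≤ C' := by positivity
  have hK0 : 0 < K := by positivity
  have hdom : ∀ x ∈ Ioo (-b) b, u0 x ≤ u0 x0 + ε + prof b x0 K n x := by
    intro x hx
    have hD := D_pos hx
    have hp : 0 ≤ prof b x0 K n x := by unfold prof; positivity
    by_cases hd : dist x x0 < δ
    · have := hball hd
      linarith
    · push Not at hd
      rw [Real.dist_eq] at hd
      have hsq : δ ^ 2 ≤ (x - x0) ^ 2 := by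
        rw [← sq_abs (x - x0)]; exact pow_le_pow_left₀ hδ.le hd 2
      have hDn : 0 < (b ^ 2 - x ^ 2) ^ n := by positivity
      have hDn2 : (b ^ 2 - x ^ 2) ^ n ≤ (b ^ 2) ^ n :=
        pow_le_pow_left₀ hD.le (by nlinarith [sq_nonneg x]) n
      have hKC : C' ≤ K * (x - x0) ^ 2 := by
        have h1 : C' = C' / δ ^ 2 * δ ^ 2 := by field_simp
        have h2 : C' / δ ^ 2 * δ ^ 2 ≤ K * (x - x0) ^ 2 :=
          mul_le_mul (by linarith) hsq (by positivity) hK0.le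
        linarith
      have h3 : (u0 x - u0 x0) * (b ^ 2 - x ^ 2) ^ n ≤ C' := by
        have a1 := hC x hx
        have a2 : -u0 x0 * (b ^ 2 - x ^ 2) ^ n ≤ |u0 x0| * (b ^ 2) ^ n :=
          mul_le_mul (neg_le_abs _) hDn2 hDn.le (abs_nonneg _)
        have a3 := le_abs_self C
        rw [sub_mul]
        linarith
      have h4 : u0 x - u0 x0 ≤ prof b x0 K n x := by
        unfold prof
        rw [inv_pow, ← div_eq_mul_inv, le_div_iff₀ hDn]
        linarith
      linarith
  obtain ⟨C1, hC1, hprof⟩ := prof_bound hn hK0 hb hx0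
  obtain ⟨C0, hC0, hgb⟩ := g_bound hα hg
  set M : ℝ := f (C1 * C0) + 1 with hM
  have hM0 : 0 ≤ M := by
    have := hf.2.1.monotone (show 0 ≤ C1 * C0 by positivity)
    rw [hf.2.2.1] at this
    linarith
  set Φ : ℝ × ℝ → ℝ := fun q => u0 x0 + ε + prof b x0 K n q.1 + M * q.2 with hΦ
  have hX : pX Φ = fun q => deriv (prof b x0 K n) q.1 := by
    funext q
    simp [pX, hΦ]
  have hXX : pXX Φ = fun q => deriv (deriv (prof b x0 K n)) q.1 := by
    funext q
    simp only [pXX, hX]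
  have hT : ∀ q, pT Φ q = M := by
    intro q
    have : HasDerivAt (fun t => Φ (q.1, t)) M q.2 := by
      simp only [hΦ]
      simpa using ((hasDerivAt_id' q.2).const_mul M).const_add (u0 x0 + ε + prof b x0 K n q.1)
    exact this.deriv
  have hprofC : ContDiffOn ℝ 2 (prof b x0 K n) (Ioo (-b) b) := by
    unfold prof
    refine ContDiffOn.mul (by fun_prop) (ContDiffOn.pow (ContDiffOn.inv (by fun_prop) ?_) n)
    exact fun x hx => (D_pos hx).ne'
  refine ⟨Φ, ⟨?_, ?_, ?_, ?_⟩, ?_⟩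
  · have h1 : ContDiffOn ℝ 2 (fun q : ℝ × ℝ => prof b x0 K n q.1) (Qset b) :=
      hprofC.comp contDiff_fst.contDiffOn fun q hq => hq.1
    exact (contDiffOn_const.add h1).add (by fun_prop)
  · have h1 : ContinuousOn (fun q : ℝ × ℝ => prof b x0 K n q.1) (Q0set b) :=
      hprofC.continuousOn.comp continuous_fst.continuousOn fun q hq => hq.1
    exact (continuousOn_const.add h1).add (by fun_prop)
  · intro q hq
    rw [hT, hX, hXX]
    have h1 := hprof q.1 hq.1
    have h2 := hgb (deriv (prof b x0 K n) q.1)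
    have h3 := mul_le_mul_of_nonneg_left h1 (hg.2.1 (deriv (prof b x0 K n) q.1)).le
    have h4 := mul_le_mul_of_nonneg_left h2 hC1
    have h5 : g (deriv (prof b x0 K n) q.1) * deriv (deriv (prof b x0 K n)) q.1 ≤ C1 * C0 := by
      linarith
    have := hf.2.1.monotone h5
    simp only [hM]
    linarith
  · intro q hq
    have h1 := hdom q.1 hq.1
    have h2 : 0 ≤ M * q.2 := mul_nonneg hM0 hq.2
    simp only [hΦ]
    linarith
  · simp [hΦ, prof]

/-- Explicit quadratic members of the Perron class. -/
lemma lower_mem {b : ℝ} {f g u0 : ℝ → ℝ} (hfm : Monotone f) (hg0 : ∀ s, 0 < g s)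
    {a s c K M : ℝ} (hM : 0 ≤ M) (hsub : ∀ p, -M ≤ f (g p * (-(2 * K))))
    (h0 : ∀ x ∈ Ioo (-b) b, a + s * (x - c) - K * (x - c) ^ 2 ≤ u0 x) :
    (fun q : ℝ × ℝ => a + s * (q.1 - c) - K * (q.1 - c) ^ 2 - M * q.2) ∈ PClass b f g u0 := by
  set ψ : ℝ × ℝ → ℝ := fun q => a + s * (q.1 - c) - K * (q.1 - c) ^ 2 - M * q.2 with hψ
  have hC : ContDiff ℝ 2 ψ := by simp only [hψ]; fun_prop
  have hX : pX ψ = fun q => s - 2 * K * (q.1 - c) := by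
    funext q
    have h1 := (hasDerivAt_id' q.1).sub_const c
    have : HasDerivAt (fun x => ψ (x, q.2)) (s - 2 * K * (q.1 - c)) q.1 := by
      simp only [hψ]
      refine ((((h1.const_mul s).const_add a).sub ((h1.pow 2).const_mul K)).sub_const
        (M * q.2)).congr_deriv ?_
      norm_num
      ring
    exact this.deriv
  have hXX : ∀ q, pXX ψ q = -(2 * K) := by
    intro q
    have : HasDerivAt (fun x => pX ψ (x, q.2)) (-(2 * K)) q.1 := by
      simp only [hX]
      simpa using (((hasDerivAt_id' q.1).sub_const c).const_mul (2 * K)).const_sub s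
    exact this.deriv
  have hT : ∀ q, pT ψ q = -M := by
    intro q
    have : HasDerivAt (fun t => ψ (q.1, t)) (-M) q.2 := by
      simp only [hψ]
      simpa using ((hasDerivAt_id' q.2).const_mul M).const_sub
        (a + s * (q.1 - c) - K * (q.1 - c) ^ 2)
    exact this.deriv
  refine ⟨⟨hC.continuous.upperSemicontinuous.upperSemicontinuousOn _, ?_⟩, ?_⟩
  · intro ζ hζ p hp hloc
    have hl : IsLocalMax (fun y => ψ y - ζ y) p := by
      have h := hloc
      unfold IsLocalMaxOn IsMaxFilter at h
      rwa [(isOpen_Qset b).nhdsWithin_eq hp] at h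
    refine smooth_test hfm hg0 hC.contDiffOn hζ hp hl ?_
    rw [hT, hXX]
    linarith [hsub (pX ψ p)]
  · intro Φ hΦ q hq
    have h1 := h0 q.1 hq.1
    have h2 := hΦ.2.2.2 q hq
    have h3 : 0 ≤ M * q.2 := mul_nonneg hM hq.2
    simp only [hψ]
    linarith

lemma affine_mem {b : ℝ} {f g u0 : ℝ → ℝ} (hf : A1 f) (hg0 : ∀ s, 0 < g s)
    {a s c : ℝ} (h0 : ∀ x ∈ Ioo (-b) b, a + s * (x - c) ≤ u0 x) :
    (fun q : ℝ × ℝ => a + s * (q.1 - c)) ∈ PClass b f g u0 := by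
  have := lower_mem (b := b) (f := f) (g := g) (u0 := u0) hf.2.1.monotone hg0
    (a := a) (s := s) (c := c) (K := 0) (M := 0) le_rfl (by simp [hf.2.2.1])
    (by simpa using h0)
  simpa using this

/-- existence for `α > 2` under (B2). -/
theorem existence_alpha_gt_two (b α : ℝ) (f g u0 : ℝ → ℝ)
    (hb : 0 < b) (hf : A1 f) (hα : 2 < α) (hg : A2 g α) (hu0 : B2 b u0) :
    ∃ u : ℝ × ℝ → ℝ, IsVSol b f g u0 u := by
  obtain ⟨m, hm⟩ := u0_lower hb hu0
  have hg0 := hg.2.1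
  obtain ⟨C0, hC0, hgb⟩ := g_bound hα hg
  have hgC : ∀ s, g s ≤ C0 := fun s => by nlinarith [hgb s, hg0 s, sq_nonneg s]
  have hA : (fun q : ℝ × ℝ => -m + 0 * (q.1 - 0)) ∈ PClass b f g u0 :=
    affine_mem hf hg0 (by simpa using hm)
  have hAc : ContinuousOn (fun q : ℝ × ℝ => -m + 0 * (q.1 - 0)) (Q0set b) := by fun_prop
  obtain ⟨Φ, hΦ, -⟩ := exists_upper hb hf hα hg hu0 (x0 := 0) (ε := 1)
    ⟨by linarith, hb⟩ one_pos
  have hAu : ∀ q ∈ Q0set b, -m + 0 * (q.1 - 0) ≤ PSup b f g u0 q :=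
    fun q hq => le_PSup hΦ hA hq
  have huΦ : ∀ q ∈ Q0set b, PSup b f g u0 q ≤ Φ q := fun q hq => PSup_le hA hΦ hq
  -- members of the class that are continuous lie below the lower envelope
  have hlow : ∀ v ∈ PClass b f g u0, Continuous v → ∀ q ∈ Q0set b,
      v q ≤ lscEnv b (PSup b f g u0) q := fun v hv hvc q hq =>
    le_lsc hΦ.2.1 huΦ hvc.continuousOn (fun q hq => le_PSup hΦ hv hq) hq
  refine ⟨PSup b f g u0, (usc_PSup_mem hf.1 hg.1 hA hAc hΦ).1,
    ⟨lsc_lsc hAc hAu hΦ.2.1 huΦ,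
      lsc_PSup_super hf.1 hf.2.1.monotone hg.1 hg0 hA hAc hΦ, ?_⟩, ?_⟩
  · intro t ht
    constructor
    · rw [tendsto_atTop]
      intro R
      set N : ℝ := max (R + 1) (-m) with hN
      obtain ⟨l, hl, hl2⟩ := (mem_nhdsLT_iff_exists_Ioo_subset' (show -b < b by linarith)).1
        (hu0.2.1.eventually_ge_atTop N)
      simp only [mem_Iio] at hl
      set s : ℝ := (N + m) / (b - l) with hs
      have hs0 : 0 ≤ s := div_nonneg (by linarith [le_max_right (R + 1) (-m)]) (by linarith)
      have hsl : s * (b - l) = N + m := div_mul_cancel₀ _ (by linarith)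
      have hmem : (fun q : ℝ × ℝ => N + s * (q.1 - b)) ∈ PClass b f g u0 := by
        apply affine_mem hf hg0
        intro x hx
        by_cases hxl : l < x
        · have h1 : N ≤ u0 x := hl2 ⟨hxl, hx.2⟩
          nlinarith [hx.2]
        · push Not at hxl
          have h1 := hm x hx
          nlinarith
      have hev : ∀ᶠ x in 𝓝[<] b, R < N + s * (x - b) := by
        apply mem_nhdsWithin_of_mem_nhds
        have hc : Continuous fun x : ℝ => N + s * (x - b) := by fun_prop
        apply hc.continuousAt.eventually (Ioi_mem_nhds _)
        simp only [sub_self, mul_zero, add_zero]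
        linarith [le_max_left (R + 1) (-m)]
      filter_upwards [hev, Ioo_mem_nhdsLT (show -b < b by linarith)] with x hx1 hx2
      exact hx1.le.trans (hlow _ hmem (by fun_prop) (x, t) ⟨hx2, ht.le⟩)
    · rw [tendsto_atTop]
      intro R
      set N : ℝ := max (R + 1) (-m) with hN
      obtain ⟨l, hl, hl2⟩ := (mem_nhdsGT_iff_exists_Ioo_subset' (show -b < b by linarith)).1
        (hu0.2.2.1.eventually_ge_atTop N)
      simp only [mem_Ioi] at hl
      set s : ℝ := -((N + m) / (l + b)) with hs
      have hs0 : s ≤ 0 := neg_nonpos.2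
        (div_nonneg (by linarith [le_max_right (R + 1) (-m)]) (by linarith))
      have hsl : s * (l + b) = -(N + m) := by
        rw [hs, neg_mul, div_mul_cancel₀ _ (by linarith)]
      have hmem : (fun q : ℝ × ℝ => N + s * (q.1 - -b)) ∈ PClass b f g u0 := by
        apply affine_mem hf hg0
        intro x hx
        by_cases hxl : x < l
        · have h1 : N ≤ u0 x := hl2 ⟨hx.1, hxl⟩
          nlinarith [hx.1]
        · push Not at hxl
          have h1 := hm x hx
          nlinarith
      have hev : ∀ᶠ x in 𝓝[>] (-b), R < N + s * (x - -b) := by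
        apply mem_nhdsWithin_of_mem_nhds
        have hc : Continuous fun x : ℝ => N + s * (x - -b) := by fun_prop
        apply hc.continuousAt.eventually (Ioi_mem_nhds _)
        simp only [sub_self, mul_zero, add_zero]
        linarith [le_max_left (R + 1) (-m)]
      filter_upwards [hev, Ioo_mem_nhdsGT (show -b < b by linarith)] with x hx1 hx2
      exact hx1.le.trans (hlow _ hmem (by fun_prop) (x, t) ⟨hx2, ht.le⟩)
  · intro x0 hx0
    have hp : ((x0, 0) : ℝ × ℝ) ∈ Q0set b := ⟨hx0, Set.mem_Ici.2 le_rfl⟩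
    have hup : uscEnv b (PSup b f g u0) (x0, 0) ≤ u0 x0 := by
      refine le_of_forall_pos_le_add fun ε hε => ?_
      obtain ⟨Ψ, hΨ, he⟩ := exists_upper hb hf hα hg hu0 hx0 hε
      rw [← he]
      exact usc_le hAc hAu hΨ.2.1 (fun q hq => PSup_le hA hΨ hq) hp
    have hdown : u0 x0 ≤ lscEnv b (PSup b f g u0) (x0, 0) := by
      refine le_of_forall_pos_le_add fun ε hε => ?_
      have hloc : ∀ᶠ x in 𝓝 x0, u0 x0 - ε < u0 x :=
        (hu0.1.continuousAt (isOpen_Ioo.mem_nhds hx0)).eventually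
          (Ioi_mem_nhds (by linarith))
      obtain ⟨δ, hδ, hball⟩ := Metric.eventually_nhds_iff.1 hloc
      set K : ℝ := |u0 x0 + m| / δ ^ 2 with hK
      have hK0 : 0 ≤ K := by positivity
      have hKδ : K * δ ^ 2 = |u0 x0 + m| := div_mul_cancel₀ _ (by positivity)
      set M : ℝ := -f (C0 * (-(2 * K))) with hM
      have hM0 : 0 ≤ M := by
        have := hf.2.1.monotone (show C0 * (-(2 * K)) ≤ 0 by nlinarith)
        rw [hf.2.2.1] at this
        linarith
      have hmem := lower_mem (b := b) (f := f) (g := g) (u0 := u0) hf.2.1.monotone hg0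
        (a := u0 x0 - ε) (s := 0) (c := x0) (K := K) (M := M) hM0
        (by
          intro p
          rw [hM, neg_neg]
          apply hf.2.1.monotone
          nlinarith [hgC p])
        (by
          intro x hx
          by_cases hd : dist x x0 < δ
          · have := hball hd
            nlinarith [sq_nonneg (x - x0)]
          · push Not at hd
            rw [Real.dist_eq] at hd
            have hsq : δ ^ 2 ≤ (x - x0) ^ 2 := by
              rw [← sq_abs (x - x0)]; exact pow_le_pow_left₀ hδ.le hd 2
            have h1 := mul_le_mul_of_nonneg_left hsq hK0
            have h2 := hm x hx
            have h3 := le_abs_self (u0 x0 + m)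
            linarith)
      have := hlow _ hmem (by fun_prop) (x0, 0) hp
      simp only [sub_self] at this
      linarith
    have hmid : lscEnv b (PSup b f g u0) (x0, 0) ≤ uscEnv b (PSup b f g u0) (x0, 0) :=
      (lsc_le hAc hAu hp).trans (le_usc hΦ.2.1 huΦ hp)
    exact ⟨by linarith, by linarith⟩
end
end

section
/- Let b>0. Assume f satisfies (A1), g satisfies (A2) with exponent α satisfying 1<α≤2, and u₀ satisfies (B1) or (B2). Then there exists a viscosity solution u:(−b,b)×[0,∞)→ℝ of the initial value problem u_t − f(g(u_x)u_{xx}) = 0 in Q, with the singular Dirichlet condition lim_{x→±b}u(x,t)=∞ for every t>0, and initial datum u₀. -/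
open Filter Set Topology

noncomputable section

lemma pT_eq_s2 {φ : ℝ × ℝ → ℝ} {p : ℝ × ℝ} (h : DifferentiableAt ℝ φ p) :
    HasDerivAt (fun t => φ (p.1, t)) (fderiv ℝ φ p (0, 1)) p.2 := by
  have h1 : HasFDerivAt φ (fderiv ℝ φ p) (p.1, p.2) := h.hasFDerivAt
  have h2 : HasDerivAt (fun t : ℝ => (p.1, t)) ((0:ℝ), (1:ℝ)) p.2 :=
    (hasDerivAt_const _ _).prodMk (hasDerivAt_id _)
  exact h1.comp_hasDerivAt p.2 h2

lemma pX_eq_s2 {φ : ℝ × ℝ → ℝ} {p : ℝ × ℝ} (h : DifferentiableAt ℝ φ p) :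
    HasDerivAt (fun x => φ (x, p.2)) (fderiv ℝ φ p (1, 0)) p.1 := by
  have h1 : HasFDerivAt φ (fderiv ℝ φ p) (p.1, p.2) := h.hasFDerivAt
  have h2 : HasDerivAt (fun t : ℝ => (t, p.2)) ((1:ℝ), (0:ℝ)) p.1 :=
    (hasDerivAt_id _).prodMk (hasDerivAt_const _ _)
  exact h1.comp_hasDerivAt p.1 h2

section C2
variable {b : ℝ} {φ : ℝ × ℝ → ℝ}

lemma C2_diffAt (h : ContDiffOn ℝ 2 φ (Qset b)) {p : ℝ × ℝ} (hp : p ∈ Qset b) :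
    DifferentiableAt ℝ φ p :=
  (h.differentiableOn (by norm_num)).differentiableAt ((isOpen_Qset b).mem_nhds hp)

lemma C2_fderiv (h : ContDiffOn ℝ 2 φ (Qset b)) (e : ℝ × ℝ) :
    ContDiffOn ℝ 1 (fun p => fderiv ℝ φ p e) (Qset b) := by
  have h1 : ContDiffOn ℝ 1 (fderiv ℝ φ) (Qset b) :=
    h.fderiv_of_isOpen (isOpen_Qset b) (by norm_num)
  exact h1.clm_apply contDiffOn_const

lemma C2_pX_eqOn (h : ContDiffOn ℝ 2 φ (Qset b)) :
    EqOn (pX φ) (fun p => fderiv ℝ φ p (1, 0)) (Qset b) :=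
  fun _ hp => (pX_eq_s2 (C2_diffAt h hp)).deriv

lemma C2_pT_eqOn (h : ContDiffOn ℝ 2 φ (Qset b)) :
    EqOn (pT φ) (fun p => fderiv ℝ φ p (0, 1)) (Qset b) :=
  fun _ hp => (pT_eq_s2 (C2_diffAt h hp)).deriv

lemma C2_pX (h : ContDiffOn ℝ 2 φ (Qset b)) : ContDiffOn ℝ 1 (pX φ) (Qset b) :=
  (C2_fderiv h (1, 0)).congr (C2_pX_eqOn h)

lemma C2_pT (h : ContDiffOn ℝ 2 φ (Qset b)) : ContDiffOn ℝ 1 (pT φ) (Qset b) :=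
  (C2_fderiv h (0, 1)).congr (C2_pT_eqOn h)

lemma C2_hT (h : ContDiffOn ℝ 2 φ (Qset b)) {p : ℝ × ℝ} (hp : p ∈ Qset b) :
    HasDerivAt (fun t => φ (p.1, t)) (pT φ p) p.2 :=
  (pT_eq_s2 (C2_diffAt h hp)).differentiableAt.hasDerivAt

lemma C2_hX (h : ContDiffOn ℝ 2 φ (Qset b)) {p : ℝ × ℝ} (hp : p ∈ Qset b) :
    HasDerivAt (fun x => φ (x, p.2)) (pX φ p) p.1 :=
  (pX_eq_s2 (C2_diffAt h hp)).differentiableAt.hasDerivAt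

lemma C2_pX_diffAt (h : ContDiffOn ℝ 2 φ (Qset b)) {p : ℝ × ℝ} (hp : p ∈ Qset b) :
    DifferentiableAt ℝ (pX φ) p :=
  ((C2_pX h).differentiableOn (by norm_num)).differentiableAt ((isOpen_Qset b).mem_nhds hp)

lemma C2_hXX (h : ContDiffOn ℝ 2 φ (Qset b)) {p : ℝ × ℝ} (hp : p ∈ Qset b) :
    HasDerivAt (fun x => pX φ (x, p.2)) (pXX φ p) p.1 :=
  (pX_eq_s2 (C2_pX_diffAt h hp)).differentiableAt.hasDerivAt

lemma C2_pXX_cont (h : ContDiffOn ℝ 2 φ (Qset b)) : ContinuousOn (pXX φ) (Qset b) := by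
  have h1 : ContinuousOn (fderiv ℝ (pX φ)) (Qset b) :=
    (C2_pX h).continuousOn_fderiv_of_isOpen (isOpen_Qset b) (by norm_num)
  have h2 : ContinuousOn (fun p => fderiv ℝ (pX φ) p (1, 0)) (Qset b) :=
    h1.clm_apply continuousOn_const
  exact h2.congr fun p hp => (pX_eq_s2 (C2_pX_diffAt h hp)).deriv

lemma line_mem {p : ℝ × ℝ} (hp : p ∈ Qset b) : ∀ᶠ x in 𝓝 p.1, ((x, p.2) : ℝ × ℝ) ∈ Qset b := by
  have : Tendsto (fun x : ℝ => ((x, p.2) : ℝ × ℝ)) (𝓝 p.1) (𝓝 p) := by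
    have : Continuous (fun x : ℝ => ((x, p.2) : ℝ × ℝ)) := by fun_prop
    exact this.tendsto p.1
  exact this.eventually ((isOpen_Qset b).mem_nhds hp)

end C2

/-- Second derivative test (necessary condition). -/
lemma second_deriv_le {h h' : ℝ → ℝ} {x c : ℝ} (hm : IsLocalMax h x)
    (h1 : ∀ᶠ y in 𝓝 x, HasDerivAt h (h' y) y) (h2 : HasDerivAt h' c x) : h' x = 0 ∧ c ≤ 0 := by
  have h0 : h' x = 0 := hm.hasDerivAt_eq_zero h1.self_of_nhds
  refine ⟨h0, ?_⟩
  by_contra hc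
  push Not at hc
  have hev : deriv h =ᶠ[𝓝 x] h' := h1.mono fun y hy => hy.deriv
  have hdd : deriv (deriv h) x = c := by rw [hev.deriv_eq, h2.deriv]
  have hmin : IsLocalMin h x :=
    isLocalMin_of_deriv_deriv_pos (by rw [hdd]; exact hc) (by rw [hev.self_of_nhds, h0])
      h1.self_of_nhds.continuousAt
  have hconst : h =ᶠ[𝓝 x] fun _ => h x := by
    filter_upwards [hm, hmin] with y a1 a2 using le_antisymm a1 a2
  have h3 : h' =ᶠ[𝓝 x] fun _ => 0 := by
    filter_upwards [hconst.eventuallyEq_nhds, h1] with y hy hy1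
    have := hy.deriv_eq
    rw [hy1.deriv] at this
    simpa using this
  have := h3.deriv_eq
  rw [h2.deriv] at this
  simp at this
  linarith

lemma touch {b : ℝ} {f g : ℝ → ℝ} (hf : StrictMono f) (hg : ∀ s, 0 < g s)
    {χ ψ : ℝ × ℝ → ℝ} {p : ℝ × ℝ} (hp : p ∈ Qset b) (hχ : ContDiffOn ℝ 2 χ (Qset b))
    (hm : IsLocalMax (fun q => ψ q - χ q) p) {ψ' : ℝ → ℝ} {a c : ℝ}
    (ha : HasDerivAt (fun t => ψ (p.1, t)) a p.2)
    (hx : ∀ᶠ x in 𝓝 p.1, HasDerivAt (fun x => ψ (x, p.2)) (ψ' x) x)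
    (hxx : HasDerivAt ψ' c p.1) (hineq : a ≤ f (g (ψ' p.1) * c)) :
    pT χ p - f (g (pX χ p) * pXX χ p) ≤ 0 := by
  have ct : Tendsto (fun t : ℝ => ((p.1, t) : ℝ × ℝ)) (𝓝 p.2) (𝓝 p) := by
    have : Continuous (fun t : ℝ => ((p.1, t) : ℝ × ℝ)) := by fun_prop
    exact this.tendsto p.2
  have cx : Tendsto (fun x : ℝ => ((x, p.2) : ℝ × ℝ)) (𝓝 p.1) (𝓝 p) := by
    have : Continuous (fun x : ℝ => ((x, p.2) : ℝ × ℝ)) := by fun_prop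
    exact this.tendsto p.1
  have m1 : IsLocalMax (fun t => ψ (p.1, t) - χ (p.1, t)) p.2 := ct.eventually hm
  have m2 : IsLocalMax (fun x => ψ (x, p.2) - χ (x, p.2)) p.1 := cx.eventually hm
  have e1 := m1.hasDerivAt_eq_zero (ha.sub (C2_hT hχ hp))
  have e2 := second_deriv_le (h' := fun x => ψ' x - pX χ (x, p.2)) m2 (by
    filter_upwards [hx, line_mem hp] with x h1 h2
    exact h1.sub (C2_hX hχ h2)) (hxx.sub (C2_hXX hχ hp))
  have e3 : pX χ p = ψ' p.1 := by have := e2.1; simp only [Prod.mk.eta] at this; linarith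
  have e4 : f (g (ψ' p.1) * c) ≤ f (g (ψ' p.1) * pXX χ p) :=
    hf.monotone (mul_le_mul_of_nonneg_left (by linarith [e2.2]) (hg _).le)
  rw [e3]; linarith

lemma isSubSol_of_touch {b : ℝ} {f g : ℝ → ℝ} (hf : StrictMono f) (hg : ∀ s, 0 < g s)
    {v : ℝ × ℝ → ℝ} (hv : UpperSemicontinuousOn v (Q0set b))
    (H : ∀ p ∈ Qset b, ∃ (ψ : ℝ × ℝ → ℝ) (ψ' : ℝ → ℝ) (a c : ℝ),
      (∀ᶠ q in 𝓝 p, ψ q ≤ v q) ∧ ψ p = v p ∧ HasDerivAt (fun t => ψ (p.1, t)) a p.2 ∧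
      (∀ᶠ x in 𝓝 p.1, HasDerivAt (fun x => ψ (x, p.2)) (ψ' x) x) ∧
      HasDerivAt ψ' c p.1 ∧ a ≤ f (g (ψ' p.1) * c)) : IsSubSol b f g v := by
  refine ⟨hv, fun χ hχ p hp hm => ?_⟩
  obtain ⟨ψ, ψ', a, c, h1, h2, h3, h4, h5, h6⟩ := H p hp
  have hm' : IsLocalMax (fun q => v q - χ q) p := hm.isLocalMax ((isOpen_Qset b).mem_nhds hp)
  refine touch hf hg hp hχ (ψ := ψ) ?_ h3 h4 h5 h6
  filter_upwards [hm', h1] with q a1 a2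
  linarith
section Env
variable {b : ℝ} {u w : ℝ × ℝ → ℝ} {m : ℝ}

lemma neBot_Q0 {p : ℝ × ℝ} (hp : p ∈ Q0set b) : (𝓝[Q0set b] p).NeBot :=
  mem_closure_iff_nhdsWithin_neBot.1 (subset_closure hp)

lemma bddU (hw : ContinuousOn w (Q0set b)) (huw : ∀ p ∈ Q0set b, u p ≤ w p) {p : ℝ × ℝ}
    (hp : p ∈ Q0set b) : (𝓝[Q0set b] p).IsBoundedUnder (· ≤ ·) u := by
  refine ⟨w p + 1, ?_⟩
  rw [eventually_map]
  have h1 := (hw p hp).eventually (gt_mem_nhds (lt_add_one (w p)))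
  filter_upwards [h1, self_mem_nhdsWithin] with q h2 h3
  exact (huw q h3).trans h2.le

lemma bddL (hm : ∀ p ∈ Q0set b, m ≤ u p) {p : ℝ × ℝ} :
    (𝓝[Q0set b] p).IsBoundedUnder (· ≥ ·) u := by
  refine ⟨m, ?_⟩
  rw [eventually_map]
  filter_upwards [self_mem_nhdsWithin] with q h3
  exact hm q h3

lemma cobU (hm : ∀ p ∈ Q0set b, m ≤ u p)
    {p : ℝ × ℝ} (hp : p ∈ Q0set b) : (𝓝[Q0set b] p).IsCoboundedUnder (· ≤ ·) u := by
  have := neBot_Q0 hp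
  exact (bddL hm).isCoboundedUnder_flip

lemma cobL (hw : ContinuousOn w (Q0set b)) (huw : ∀ p ∈ Q0set b, u p ≤ w p)
    {p : ℝ × ℝ} (hp : p ∈ Q0set b) : (𝓝[Q0set b] p).IsCoboundedUnder (· ≥ ·) u := by
  have := neBot_Q0 hp
  exact (bddU hw huw hp).isCoboundedUnder_flip

lemma le_uscEnv (hw : ContinuousOn w (Q0set b)) (huw : ∀ p ∈ Q0set b, u p ≤ w p)
    {p : ℝ × ℝ} (hp : p ∈ Q0set b) : u p ≤ uscEnv b u p := by
  by_contra h
  push Not at h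
  have := eventually_lt_of_limsup_lt h (bddU hw huw hp)
  exact lt_irrefl _ (this.self_of_nhdsWithin hp)

lemma lscEnv_le (hm : ∀ p ∈ Q0set b, m ≤ u p)
    {p : ℝ × ℝ} (hp : p ∈ Q0set b) : lscEnv b u p ≤ u p := by
  by_contra h
  push Not at h
  have := eventually_lt_of_lt_liminf h (bddL hm)
  exact lt_irrefl _ (this.self_of_nhdsWithin hp)

lemma uscEnv_le (hm : ∀ p ∈ Q0set b, m ≤ u p)
    {v : ℝ × ℝ → ℝ} (hv : ContinuousOn v (Q0set b)) (huv : ∀ p ∈ Q0set b, u p ≤ v p)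
    {p : ℝ × ℝ} (hp : p ∈ Q0set b) : uscEnv b u p ≤ v p := by
  refine le_of_forall_pos_le_add fun ε hε => ?_
  refine limsup_le_of_le (cobU hm hp) ?_
  filter_upwards [(hv p hp).eventually (gt_mem_nhds (show v p < v p + ε by linarith)),
    self_mem_nhdsWithin] with q h1 h2
  exact (huv q h2).trans h1.le

lemma le_lscEnv' (hw : ContinuousOn w (Q0set b)) (huw : ∀ p ∈ Q0set b, u p ≤ w p)
    {v : ℝ × ℝ → ℝ} {p : ℝ × ℝ} (hp : p ∈ Q0set b)
    (hv : ContinuousWithinAt v (Q0set b) p)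
    (huv : ∀ᶠ q in 𝓝[Q0set b] p, v q ≤ u q) : v p ≤ lscEnv b u p := by
  refine le_of_forall_sub_le fun ε hε => ?_
  refine le_liminf_of_le (cobL hw huw hp) ?_
  filter_upwards [hv.eventually (lt_mem_nhds (show v p - ε < v p by linarith)),
    huv] with q h1 h2
  exact h1.le.trans h2

lemma le_lscEnv (hw : ContinuousOn w (Q0set b)) (huw : ∀ p ∈ Q0set b, u p ≤ w p)
    {v : ℝ × ℝ → ℝ} (hv : ContinuousOn v (Q0set b)) (huv : ∀ p ∈ Q0set b, v p ≤ u p)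
    {p : ℝ × ℝ} (hp : p ∈ Q0set b) : v p ≤ lscEnv b u p :=
  le_lscEnv' hw huw hp (hv p hp) (by filter_upwards [self_mem_nhdsWithin] with q hq using huv q hq)

lemma usc_uscEnv (hw : ContinuousOn w (Q0set b)) (huw : ∀ p ∈ Q0set b, u p ≤ w p) (hm : ∀ p ∈ Q0set b, m ≤ u p)
    : UpperSemicontinuousOn (uscEnv b u) (Q0set b) := by
  intro p hp y hy
  obtain ⟨z, hz1, hz2⟩ := exists_between hy
  have h1 := eventually_lt_of_limsup_lt hz1 (bddU hw huw hp)
  filter_upwards [eventually_eventually_nhdsWithin.2 h1, self_mem_nhdsWithin] with q h2 h3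
  exact lt_of_le_of_lt (limsup_le_of_le (cobU hm h3) (h2.mono fun _ h => h.le)) hz2

lemma lsc_lscEnv (hw : ContinuousOn w (Q0set b)) (huw : ∀ p ∈ Q0set b, u p ≤ w p) (hm : ∀ p ∈ Q0set b, m ≤ u p)
    : LowerSemicontinuousOn (lscEnv b u) (Q0set b) := by
  intro p hp y hy
  obtain ⟨z, hz1, hz2⟩ := exists_between hy
  have h1 := eventually_lt_of_lt_liminf hz2 (bddL hm)
  filter_upwards [eventually_eventually_nhdsWithin.2 h1, self_mem_nhdsWithin] with q h2 h3
  exact lt_of_lt_of_le hz1 (le_liminf_of_le (cobL hw huw h3) (h2.mono fun _ h => h.le))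

end Env

/-- quartic perturbation -/
def quart (p q : ℝ × ℝ) : ℝ := (q.1 - p.1) ^ 4 + (q.2 - p.2) ^ 4

lemma quart_nonneg (p q : ℝ × ℝ) : 0 ≤ quart p q := by unfold quart; positivity

lemma quart_self (p : ℝ × ℝ) : quart p p = 0 := by simp [quart]

lemma quart_ge {p q : ℝ × ℝ} {r : ℝ} (hr : 0 ≤ r) (h : r ≤ dist q p) : r ^ 4 ≤ quart p q := by
  rw [Prod.dist_eq, le_max_iff, Real.dist_eq, Real.dist_eq] at h
  unfold quart
  have e1 : ∀ x : ℝ, x ^ 4 = |x| ^ 4 := fun x => (Even.pow_abs (by decide) x).symm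
  rcases h with h | h
  · have := pow_le_pow_left₀ hr h 4
    rw [← e1] at this
    have h2 : 0 ≤ (q.2 - p.2) ^ 4 := by positivity
    linarith
  · have := pow_le_pow_left₀ hr h 4
    rw [← e1] at this
    have h2 : 0 ≤ (q.1 - p.1) ^ 4 := by positivity
    linarith

section Pert
variable {b : ℝ} {φ : ℝ × ℝ → ℝ}

lemma quart_C2 (p : ℝ × ℝ) (s k : ℝ) : ContDiff ℝ 2 (fun q => s * quart p q + k) := by
  unfold quart; fun_prop

lemma pert_C2 (h : ContDiffOn ℝ 2 φ (Qset b)) (p : ℝ × ℝ) (s k : ℝ) :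
    ContDiffOn ℝ 2 (fun q => φ q + (s * quart p q + k)) (Qset b) :=
  h.add (quart_C2 p s k).contDiffOn

lemma quart_dx (p q : ℝ × ℝ) (s k : ℝ) :
    HasDerivAt (fun x => s * quart p (x, q.2) + k) (s * (4 * (q.1 - p.1) ^ 3)) q.1 := by
  unfold quart
  have := (((((hasDerivAt_id q.1).sub_const p.1).pow 4).add_const ((q.2 - p.2) ^ 4)).const_mul
    s).add_const k
  simpa using this

lemma pert_pT (h : ContDiffOn ℝ 2 φ (Qset b)) {p : ℝ × ℝ} (hp : p ∈ Qset b) (s k : ℝ) :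
    pT (fun q => φ q + (s * quart p q + k)) p = pT φ p := by
  have h2 : HasDerivAt (fun t => s * quart p (p.1, t) + k) 0 p.2 := by
    unfold quart
    have := (((((hasDerivAt_id p.2).sub_const p.2).pow 4).const_add ((p.1 - p.1) ^ 4)).const_mul
      s).add_const k
    simpa using this
  have := ((C2_hT h hp).add h2).deriv
  rw [add_zero] at this
  exact this

lemma pert_pX (h : ContDiffOn ℝ 2 φ (Qset b)) {p q : ℝ × ℝ} (hq : q ∈ Qset b) (s k : ℝ) :
    pX (fun q => φ q + (s * quart p q + k)) q = pX φ q + s * (4 * (q.1 - p.1) ^ 3) :=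
  ((C2_hX h hq).add (quart_dx p q s k)).deriv

lemma pert_pXX (h : ContDiffOn ℝ 2 φ (Qset b)) {p : ℝ × ℝ} (hp : p ∈ Qset b) (s k : ℝ) :
    pXX (fun q => φ q + (s * quart p q + k)) p = pXX φ p := by
  have h2 : HasDerivAt (fun x => s * (4 * (x - p.1) ^ 3)) 0 p.1 := by
    have := ((((hasDerivAt_id p.1).sub_const p.1).pow 3).const_mul 4).const_mul s
    simpa using this
  have h3 := (C2_hXX h hp).add h2
  rw [add_zero] at h3
  refine HasDerivAt.deriv (h3.congr_of_eventuallyEq ?_)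
  filter_upwards [line_mem hp] with x hx
  exact pert_pX h hx s k

/-- The operator. -/
def FF (f g : ℝ → ℝ) (φ : ℝ × ℝ → ℝ) (q : ℝ × ℝ) : ℝ := pT φ q - f (g (pX φ q) * pXX φ q)

lemma FF_cont {f g : ℝ → ℝ} (hf : Continuous f) (hg : Continuous g)
    (h : ContDiffOn ℝ 2 φ (Qset b)) : ContinuousOn (FF f g φ) (Qset b) := by
  have h1 := (C2_pT h).continuousOn
  have h2 := (C2_pX h).continuousOn
  have h3 := C2_pXX_cont h
  exact h1.sub (hf.comp_continuousOn ((hg.comp_continuousOn h2).mul h3))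

lemma pert_FF {f g : ℝ → ℝ} (h : ContDiffOn ℝ 2 φ (Qset b)) {p : ℝ × ℝ} (hp : p ∈ Qset b)
    (s k : ℝ) : FF f g (fun q => φ q + (s * quart p q + k)) p = FF f g φ p := by
  unfold FF
  rw [pert_pT h hp, pert_pXX h hp, pert_pX h hp]
  simp

end Pert

lemma exists_ball {b : ℝ} {P : ℝ × ℝ → Prop} {p : ℝ × ℝ} (hp : p ∈ Qset b)
    (h : ∀ᶠ q in 𝓝 p, P q) : ∃ r > 0, Metric.closedBall p r ⊆ Qset b ∧
      ∀ q ∈ Metric.closedBall p r, P q := by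
  have h1 : ∀ᶠ q in 𝓝 p, q ∈ Qset b ∧ P q := (show ∀ᶠ q in 𝓝 p, q ∈ Qset b from (isOpen_Qset b).mem_nhds hp).and h
  obtain ⟨r, hr, h2⟩ := Metric.nhds_basis_closedBall.eventually_iff.1 h1
  exact ⟨r, hr, fun q hq => (h2 hq).1, fun q hq => (h2 hq).2⟩

/-- Sup of sub-solutions. -/
lemma supSub {b : ℝ} {f g : ℝ → ℝ} (hf : Continuous f) (hg : Continuous g)
    {u w : ℝ × ℝ → ℝ} {m : ℝ}
    (hw : ContinuousOn w (Q0set b)) (huw : ∀ p ∈ Q0set b, u p ≤ w p)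
    (hm : ∀ p ∈ Q0set b, m ≤ u p)
    (hsup : ∀ p ∈ Q0set b, ∀ y < u p, ∃ v, IsSubSol b f g v ∧ (∀ q ∈ Q0set b, v q ≤ u q) ∧
      y < v p) : IsSubSol b f g (uscEnv b u) := by
  refine ⟨usc_uscEnv hw huw hm, fun φ hφ p hp hmax => ?_⟩
  by_contra hcon
  push Not at hcon
  have hmax' : IsLocalMax (fun q => uscEnv b u q - φ q) p :=
    hmax.isLocalMax ((isOpen_Qset b).mem_nhds hp)
  set ψ : ℝ × ℝ → ℝ := fun q => φ q + (1 * quart p q + 0) with hψ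
  have hψC : ContDiffOn ℝ 2 ψ (Qset b) := pert_C2 hφ p 1 0
  have hF : 0 < FF f g ψ p := by rw [hψ, pert_FF hφ hp]; exact hcon
  have hFe : ∀ᶠ q in 𝓝 p, 0 < FF f g ψ q :=
    ((FF_cont hf hg hψC).continuousAt ((isOpen_Qset b).mem_nhds hp)).eventually (lt_mem_nhds hF)
  obtain ⟨r, hr, hrQ, hrP⟩ := exists_ball hp (hFe.and hmax')
  have hp0 := Qset_sub b hp
  set c := uscEnv b u p - φ p with hc
  have hlim : ∃ᶠ q in 𝓝[Q0set b] p, uscEnv b u p - r ^ 4 / 2 < u q := by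
    refine frequently_lt_of_lt_limsup (cobU hm hp0) ?_
    have : 0 < r ^ 4 := by positivity
    show _ < uscEnv b u p
    linarith
  have hψc : ∀ᶠ q in 𝓝[Q0set b] p, ψ q < φ p + r ^ 4 / 2 := by
    have h1 : ContinuousAt ψ p := (C2_diffAt hψC hp).continuousAt
    have h2 : ψ p < φ p + r ^ 4 / 2 := by
      have : 0 < r ^ 4 := by positivity
      simp only [hψ, quart_self]; linarith
    exact nhdsWithin_le_nhds (h1.eventually (gt_mem_nhds h2))
  have hball : ∀ᶠ q in 𝓝[Q0set b] p, q ∈ Metric.closedBall p r :=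
    nhdsWithin_le_nhds (Metric.closedBall_mem_nhds p hr)
  obtain ⟨q, ⟨hq1, hq2⟩, hq3⟩ := ((hlim.and_eventually hψc).and_eventually hball).exists
  obtain ⟨v, hv, hvu, hvq⟩ := hsup q (Qset_sub b (hrQ hq3)) _ hq1
  have husc : UpperSemicontinuousOn (fun z => v z + (-ψ z)) (Metric.closedBall p r) :=
    (hv.1.mono (hrQ.trans (Qset_sub b))).add
      ((hψC.continuousOn.mono hrQ).neg.upperSemicontinuousOn)
  obtain ⟨z, hz, hzmax⟩ := husc.exists_isMaxOn ⟨q, hq3⟩ (isCompact_closedBall p r)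
  have h5 : v q + -ψ q ≤ v z + -ψ z := hzmax hq3
  have hzball : z ∈ Metric.ball p r := by
    by_contra hzb
    have hd : r ≤ dist z p := by simpa using hzb
    have h6 := quart_ge hr.le hd
    have h7 : uscEnv b u z - φ z ≤ c := (hrP z hz).2
    have h8 : v z ≤ uscEnv b u z :=
      (hvu z (Qset_sub b (hrQ hz))).trans (le_uscEnv hw huw (Qset_sub b (hrQ hz)))
    have h9 : ψ z = φ z + quart p z := by simp [hψ]
    linarith
  have hloc : IsLocalMaxOn (fun q => v q - ψ q) (Qset b) z := by
    have : ∀ᶠ y in 𝓝 z, v y - ψ y ≤ v z - ψ z := by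
      filter_upwards [Metric.isOpen_ball.mem_nhds hzball] with y hy
      have := hzmax (Metric.ball_subset_closedBall hy)
      simp only [mem_ofPred_eq] at this
      linarith
    exact nhdsWithin_le_nhds this
  have := hv.2 ψ hψC z (hrQ hz) hloc
  have h10 := (hrP z hz).1
  unfold FF at h10
  linarith
/-- The Perron class. -/
def Cls (b : ℝ) (f g u0 D : ℝ → ℝ) (v : ℝ × ℝ → ℝ) : Prop :=
  IsSubSol b f g v ∧ (∀ x ∈ Ioo (-b) b, v (x, 0) ≤ u0 x) ∧
  ∀ η : ℝ, 0 < η → ∃ M B : ℝ, ∀ p ∈ Q0set b, v p ≤ M + η * D p.1 + B * p.2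

lemma perron_bump {b : ℝ} {f g u0 D : ℝ → ℝ} (hf : Continuous f) (hfm : StrictMono f)
    (hg : Continuous g) (hg0 : ∀ s, 0 < g s) (hD0 : ∀ x ∈ Ioo (-b) b, 0 ≤ D x)
    {u w : ℝ × ℝ → ℝ} {m : ℝ}
    (hw : ContinuousOn w (Q0set b)) (huw : ∀ p ∈ Q0set b, u p ≤ w p)
    (hm : ∀ p ∈ Q0set b, m ≤ u p)
    (hu : Cls b f g u0 D u) (hmaxl : ∀ v, Cls b f g u0 D v → ∀ p ∈ Q0set b, v p ≤ u p)
    (φ : ℝ × ℝ → ℝ) (hφ : ContDiffOn ℝ 2 φ (Qset b)) (p : ℝ × ℝ) (hp : p ∈ Qset b)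
    (hmin : IsLocalMinOn (fun q => lscEnv b u q - φ q) (Qset b) p) :
    0 ≤ pT φ p - f (g (pX φ p) * pXX φ p) := by
  by_contra hcon
  push Not at hcon
  have hmin' : IsLocalMin (fun q => lscEnv b u q - φ q) p :=
    hmin.isLocalMin ((isOpen_Qset b).mem_nhds hp)
  have hp0 := Qset_sub b hp
  set c := lscEnv b u p - φ p with hc
  have key : ∃ r > 0, Metric.closedBall p r ⊆ Qset b ∧ ∀ q ∈ Metric.closedBall p r,
      FF f g (fun q => φ q + ((-1) * quart p q + 0)) q < 0 ∧ c ≤ lscEnv b u q - φ q := by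
    have hψC : ContDiffOn ℝ 2 (fun q => φ q + ((-1) * quart p q + 0)) (Qset b) :=
      pert_C2 hφ p (-1) 0
    have hF : FF f g (fun q => φ q + ((-1) * quart p q + 0)) p < 0 := by
      rw [pert_FF hφ hp]; exact hcon
    exact exists_ball hp ((((FF_cont hf hg hψC).continuousAt
      ((isOpen_Qset b).mem_nhds hp)).eventually (gt_mem_nhds hF)).and hmin')
  obtain ⟨r, hr, hrQ, hrP⟩ := key
  set κ : ℝ := r ^ 4 / 2 with hκ
  have hκ0 : 0 < κ := by positivity
  set ψ : ℝ × ℝ → ℝ := fun q => φ q + ((-1) * quart p q + (c + κ)) with hψ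
  have hψC : ContDiffOn ℝ 2 ψ (Qset b) := pert_C2 hφ p (-1) (c + κ)
  have hψF : ∀ q ∈ Metric.closedBall p r, FF f g ψ q < 0 := by
    intro q hq
    have h1 := (hrP q hq).1
    have e : ψ = fun q => (fun q => φ q + ((-1) * quart p q + 0)) q +
        (0 * quart p q + (c + κ)) := by
      funext z; simp only [hψ]; ring
    have hC0 : ContDiffOn ℝ 2 (fun q => φ q + ((-1) * quart p q + 0)) (Qset b) :=
      pert_C2 hφ p (-1) 0
    have e2 : ψ = fun z => (fun q => φ q + ((-1) * quart p q + 0)) z +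
        (0 * quart q z + (c + κ)) := by
      funext z; simp only [hψ]; ring
    rw [e2, pert_FF hC0 (hrQ hq)]
    exact h1
  have hout : ∀ q ∈ Metric.closedBall p r, κ < quart p q → ψ q < u q := by
    intro q hq hk
    have h1 := (hrP q hq).2
    have h2 := lscEnv_le hm (Qset_sub b (hrQ hq))
    simp only [hψ]; linarith
  set V : ℝ × ℝ → ℝ := fun q => open Classical in
    if q ∈ Metric.ball p r then max (u q) (ψ q) else u q with hV
  have huV : ∀ q, u q ≤ V q := by
    intro q; simp only [hV]; split_ifs
    · exact le_max_left _ _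
    · exact le_rfl
  have hVin : ∀ q ∈ Metric.ball p r, V q = max (u q) (ψ q) := by
    intro q hq; simp only [hV]; rw [if_pos hq]
  have hVout : ∀ q, q ∉ Metric.ball p r → V q = u q := by
    intro q hq; simp only [hV]; rw [if_neg hq]
  have hψcont : ContinuousOn ψ (Qset b) := hψC.continuousOn
  have hVcls : Cls b f g u0 D V := by
    refine ⟨⟨?_, ?_⟩, ?_, ?_⟩
    · intro q hq
      by_cases hqb : q ∈ Metric.ball p r
      · have hQ : q ∈ Qset b := hrQ (Metric.ball_subset_closedBall hqb)
        intro y hy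
        have hy' : u q < y ∧ ψ q < y := by
          have : V q < y := hy
          rw [hVin q hqb] at this; exact max_lt_iff.1 this
        have h1 := hu.1.1 q hq y hy'.1
        have h2 : ∀ᶠ z in 𝓝 q, ψ z < y :=
          (hψcont.continuousAt ((isOpen_Qset b).mem_nhds hQ)).eventually (gt_mem_nhds hy'.2)
        filter_upwards [h1, nhdsWithin_le_nhds h2,
          nhdsWithin_le_nhds (Metric.isOpen_ball.mem_nhds hqb)] with z a1 a2 a3
        show V z < y
        rw [hVin z a3]; exact max_lt a1 a2
      · have hev : ∀ᶠ z in 𝓝 q, κ < quart p z := by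
          have hcont : Continuous (fun z => quart p z) := by unfold quart; fun_prop
          have h1 : κ < quart p q := by
            have := quart_ge hr.le (show r ≤ dist q p by simpa using hqb)
            linarith
          exact hcont.continuousAt.eventually (lt_mem_nhds h1)
        have hVe : ∀ᶠ z in 𝓝 q, V z = u z := by
          filter_upwards [hev] with z hz
          by_cases hzb : z ∈ Metric.ball p r
          · rw [hVin z hzb]
            exact max_eq_left (hout z (Metric.ball_subset_closedBall hzb) hz).le
          · exact hVout z hzb
        intro y hy
        have hy' : u q < y := by rw [← hVout q hqb]; exact hy
        have h1 := hu.1.1 q hq y hy'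
        filter_upwards [h1, nhdsWithin_le_nhds hVe] with z a1 a2
        show V z < y
        rw [a2]; exact a1
    · intro χ hχ q hq hmx
      have hmx' : IsLocalMax (fun z => V z - χ z) q :=
        hmx.isLocalMax ((isOpen_Qset b).mem_nhds hq)
      by_cases hVu : V q = u q
      · refine hu.1.2 χ hχ q hq ?_
        have : ∀ᶠ z in 𝓝 q, u z - χ z ≤ u q - χ q := by
          filter_upwards [hmx'] with z hz
          have := huV z
          rw [hVu] at hz
          linarith
        exact nhdsWithin_le_nhds this
      · have hqb : q ∈ Metric.ball p r := by
          by_contra h; exact hVu (hVout q h)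
        have hVψ : V q = ψ q := by
          rw [hVin q hqb] at hVu ⊢
          rcases max_choice (u q) (ψ q) with h | h
          · exact absurd h hVu
          · exact h
        have hF := hψF q (Metric.ball_subset_closedBall hqb)
        unfold FF at hF
        refine touch hfm hg0 hq hχ (ψ := ψ) (ψ' := fun x => pX ψ (x, q.2)) ?_ (C2_hT hψC hq) ?_
          (C2_hXX hψC hq) ?_
        · filter_upwards [hmx', Metric.isOpen_ball.mem_nhds hqb] with z hz hzb
          rw [hVψ, hVin z hzb] at hz
          have := le_max_right (u z) (ψ z)
          linarith
        · filter_upwards [line_mem hq] with x hx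
          exact C2_hX hψC hx
        · simp only [Prod.mk.eta]; linarith
    · intro x hx
      rw [hVout]
      · exact hu.2.1 x hx
      · intro hb
        have := (hrQ (Metric.ball_subset_closedBall hb)).2
        exact lt_irrefl _ (show (0:ℝ) < 0 from this)
    · intro η hη
      obtain ⟨M, B, hMB⟩ := hu.2.2 η hη
      obtain ⟨M', hM'⟩ := (isCompact_closedBall p r).bddAbove_image (hψcont.mono hrQ)
      refine ⟨max M M', max B 0, fun q hq => ?_⟩
      have hq2 : (0:ℝ) ≤ q.2 := hq.2
      have hDq := mul_nonneg hη.le (hD0 q.1 hq.1)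
      have i1 : B * q.2 ≤ max B 0 * q.2 := mul_le_mul_of_nonneg_right (le_max_left _ _) hq2
      have i2 : 0 ≤ max B 0 * q.2 := mul_nonneg (le_max_right _ _) hq2
      have i3 := hMB q hq
      have hl := le_max_left M M'
      have hrr := le_max_right M M'
      by_cases hqb : q ∈ Metric.ball p r
      · rw [hVin q hqb]
        have i4 : ψ q ≤ M' := hM' ⟨q, Metric.ball_subset_closedBall hqb, rfl⟩
        refine max_le ?_ ?_ <;> linarith
      · rw [hVout q hqb]; linarith
  have hle : ψ p ≤ lscEnv b u p := by
    refine le_lscEnv' hw huw hp0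
      (hψcont.continuousAt ((isOpen_Qset b).mem_nhds hp)).continuousWithinAt ?_
    filter_upwards [nhdsWithin_le_nhds (Metric.ball_mem_nhds p hr), self_mem_nhdsWithin]
      with q hq hq0
    have := hmaxl V hVcls q hq0
    rw [hVin q hq] at this
    exact (le_max_right _ _).trans this
  simp only [hψ, quart_self] at hle
  linarith

theorem perron {b : ℝ} (hb : 0 < b) {f g u0 D : ℝ → ℝ} (hf : Continuous f) (hfm : StrictMono f)
    (hg : Continuous g) (hg0 : ∀ s, 0 < g s) (hD0 : ∀ x ∈ Ioo (-b) b, 0 ≤ D x)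
    (hDc : ContinuousOn D (Ioo (-b) b)) {m : ℝ}
    (Hm : Cls b f g u0 D (fun _ => m))
    (Hup : ∀ x0 ∈ Ioo (-b) b, ∀ ε > 0, ∃ w : ℝ × ℝ → ℝ, ContinuousOn w (Q0set b) ∧
      w (x0, 0) ≤ u0 x0 + ε ∧ ∀ v, Cls b f g u0 D v → ∀ p ∈ Q0set b, v p ≤ w p)
    (Hgr : ∀ η : ℝ, 0 < η → ∃ M B : ℝ, ∀ v, Cls b f g u0 D v → ∀ p ∈ Q0set b,
      v p ≤ M + η * D p.1 + B * p.2)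
    (Hlo : ∀ x0 ∈ Ioo (-b) b, ∀ ε > 0, ∃ v : ℝ × ℝ → ℝ, Cls b f g u0 D v ∧
      ContinuousOn v (Q0set b) ∧ u0 x0 - ε ≤ v (x0, 0))
    (Hbc : ∀ t > 0, ∀ M : ℝ, ∃ v : ℝ × ℝ → ℝ, Cls b f g u0 D v ∧
      ContinuousOn v (Q0set b) ∧ ∀ᶠ x in 𝓝[<] b, M ≤ v (x, t))
    (Hbc' : ∀ t > 0, ∀ M : ℝ, ∃ v : ℝ × ℝ → ℝ, Cls b f g u0 D v ∧
      ContinuousOn v (Q0set b) ∧ ∀ᶠ x in 𝓝[>] (-b), M ≤ v (x, t)) :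
    ∃ u : ℝ × ℝ → ℝ, IsVSol b f g u0 u := by
  set u : ℝ × ℝ → ℝ := fun p => sSup {y | ∃ v, Cls b f g u0 D v ∧ v p = y} with hu
  obtain ⟨w, hw, -, hvw⟩ := Hup 0 ⟨by linarith, hb⟩ 1 one_pos
  have hne : ∀ p, {y | ∃ v, Cls b f g u0 D v ∧ v p = y}.Nonempty := fun p => ⟨m, _, Hm, rfl⟩
  have hbd : ∀ p ∈ Q0set b, BddAbove {y | ∃ v, Cls b f g u0 D v ∧ v p = y} := by
    intro p hp
    refine ⟨w p, ?_⟩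
    rintro y ⟨v, hv, rfl⟩
    exact hvw v hv p hp
  have hle : ∀ v, Cls b f g u0 D v → ∀ p ∈ Q0set b, v p ≤ u p :=
    fun v hv p hp => le_csSup (hbd p hp) ⟨v, hv, rfl⟩
  have hul : ∀ p ∈ Q0set b, ∀ y, (∀ v, Cls b f g u0 D v → v p ≤ y) → u p ≤ y := by
    intro p _ y h
    refine csSup_le (hne p) ?_
    rintro z ⟨v, hv, rfl⟩
    exact h v hv
  have huw : ∀ p ∈ Q0set b, u p ≤ w p := fun p hp => hul p hp _ fun v hv => hvw v hv p hp
  have hm : ∀ p ∈ Q0set b, m ≤ u p := hle _ Hm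
  have hx0 : ∀ x ∈ Ioo (-b) b, ((x, 0) : ℝ × ℝ) ∈ Q0set b := fun x hx =>
    ⟨hx, le_refl (0:ℝ)⟩
  have hE0 : ∀ x ∈ Ioo (-b) b, uscEnv b u (x, 0) ≤ u0 x := by
    intro x hx
    refine le_of_forall_pos_le_add fun ε hε => ?_
    obtain ⟨w', hw', h1, h2⟩ := Hup x hx ε hε
    exact (uscEnv_le hm hw' (fun p hp => hul p hp _ fun v hv => h2 v hv p hp) (hx0 x hx)).trans h1
  have hEsub : IsSubSol b f g (uscEnv b u) := by
    refine supSub hf hg hw huw hm fun p hp y hy => ?_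
    obtain ⟨_, ⟨v, hv, rfl⟩, h2⟩ := exists_lt_of_lt_csSup (hne p) hy
    exact ⟨v, hv.1, hle v hv, h2⟩
  have hEcls : Cls b f g u0 D (uscEnv b u) := by
    refine ⟨hEsub, hE0, fun η hη => ?_⟩
    obtain ⟨M, B, h⟩ := Hgr η hη
    refine ⟨M, B, fun p hp => ?_⟩
    refine uscEnv_le (v := fun p => M + η * D p.1 + B * p.2) hm ?_
      (fun p hp => hul p hp _ fun v hv => h v hv p hp) hp
    have : ContinuousOn (fun p : ℝ × ℝ => D p.1) (Q0set b) :=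
      hDc.comp continuous_fst.continuousOn fun p hp => hp.1
    exact (continuousOn_const.add (continuousOn_const.mul this)).add
      (continuousOn_const.mul continuous_snd.continuousOn)
  have hEu : ∀ p ∈ Q0set b, uscEnv b u p = u p := fun p hp =>
    le_antisymm (hle _ hEcls p hp) (le_uscEnv hw huw hp)
  have hucls : Cls b f g u0 D u := by
    refine ⟨⟨?_, ?_⟩, ?_, ?_⟩
    · intro p hp y hy
      have h1 := hEsub.1 p hp y (by
        show uscEnv b u p < y
        rw [hEu p hp]; exact hy)
      filter_upwards [h1, self_mem_nhdsWithin] with q a1 a2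
      show u q < y
      rw [← hEu q a2]; exact a1
    · intro φ hφ p hp hmx
      refine hEsub.2 φ hφ p hp ?_
      filter_upwards [hmx, self_mem_nhdsWithin] with q a1 a2
      rw [hEu q (Qset_sub b a2), hEu p (Qset_sub b hp)]; exact a1
    · intro x hx
      rw [← hEu _ (hx0 x hx)]; exact hE0 x hx
    · intro η hη
      obtain ⟨M, B, h⟩ := hEcls.2.2 η hη
      exact ⟨M, B, fun p hp => by rw [← hEu p hp]; exact h p hp⟩
  have hlo : ∀ x ∈ Ioo (-b) b, u0 x ≤ lscEnv b u (x, 0) := by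
    intro x hx
    refine le_of_forall_sub_le fun ε hε => ?_
    obtain ⟨v, hv, hvc, h1⟩ := Hlo x hx ε hε
    exact h1.trans (le_lscEnv hw huw hvc (hle v hv) (hx0 x hx))
  refine ⟨u, hEsub, ⟨lsc_lscEnv hw huw hm, ?_, ?_⟩, ?_⟩
  · exact perron_bump hf hfm hg hg0 hD0 hw huw hm hucls hle
  · intro t ht
    constructor
    · rw [tendsto_atTop]
      intro M
      obtain ⟨v, hv, hvc, h1⟩ := Hbc t ht M
      have h2 : ∀ᶠ x in 𝓝[<] b, x ∈ Ioo (-b) b := Ioo_mem_nhdsLT (by linarith)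
      filter_upwards [h1, h2] with x a1 a2
      exact a1.trans (le_lscEnv hw huw hvc (hle v hv) ⟨a2, ht.le⟩)
    · rw [tendsto_atTop]
      intro M
      obtain ⟨v, hv, hvc, h1⟩ := Hbc' t ht M
      have h2 : ∀ᶠ x in 𝓝[>] (-b), x ∈ Ioo (-b) b := Ioo_mem_nhdsGT (by linarith)
      filter_upwards [h1, h2] with x a1 a2
      exact a1.trans (le_lscEnv hw huw hvc (hle v hv) ⟨a2, ht.le⟩)
  · intro x hx
    have a1 := hlo x hx
    have a2 := lscEnv_le hm (hx0 x hx)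
    have a3 := hE0 x hx
    have a4 := hEu _ (hx0 x hx)
    constructor <;> linarith
/-- Comparison of members of the Perron class with smooth super-solutions. -/
lemma comparison {b : ℝ} {f g u0 D S S' S'' : ℝ → ℝ} {c0 η B : ℝ} (hη : 0 < η) (hB0 : 0 ≤ B)
    (hD0 : ∀ x ∈ Ioo (-b) b, 0 ≤ D x)
    (hDinf : ∀ R : ℝ, ∃ r : ℝ, r < b ∧ ∀ x ∈ Ioo (-b) b, D x ≤ R → x ∈ Icc (-r) r)
    (hSC : ContDiffOn ℝ 2 S (Ioo (-b) b))
    (hS1 : ∀ x ∈ Ioo (-b) b, HasDerivAt S (S' x) x)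
    (hS2 : ∀ x ∈ Ioo (-b) b, HasDerivAt S' (S'' x) x)
    (hSB : ∀ x ∈ Ioo (-b) b, f (g (S' x) * S'' x) ≤ B)
    (hS0 : ∀ x ∈ Ioo (-b) b, u0 x ≤ S x)
    (hSD : ∀ x ∈ Ioo (-b) b, c0 + η * D x ≤ S x)
    {v : ℝ × ℝ → ℝ} (hv : Cls b f g u0 D v) {p : ℝ × ℝ} (hp : p ∈ Q0set b) :
    v p ≤ S p.1 + B * p.2 := by
  by_contra hcon
  push Not at hcon
  have hp2 : (0:ℝ) ≤ p.2 := hp.2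
  obtain ⟨δ, hδ, hδp⟩ : ∃ δ > 0, δ * (p.2 + p.2 ^ 2) < v p - (S p.1 + B * p.2) := by
    refine ⟨(v p - (S p.1 + B * p.2)) / (2 * (p.2 + p.2 ^ 2 + 1)), by
      apply div_pos <;> [linarith; positivity], ?_⟩
    rw [div_mul_eq_mul_div, div_lt_iff₀ (by positivity)]
    apply mul_lt_mul_of_pos_left _ (by linarith)
    nlinarith
  obtain ⟨M, B1, hMB⟩ := hv.2.2 (η / 2) (by positivity)
  set φ : ℝ × ℝ → ℝ := fun q => S q.1 + B * q.2 + δ * (q.2 + q.2 ^ 2) with hφ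
  have hφC0 : ContinuousOn φ (Q0set b) := by
    have : ContinuousOn (fun q : ℝ × ℝ => S q.1) (Q0set b) :=
      hSC.continuousOn.comp continuous_fst.continuousOn fun q hq => hq.1
    exact (this.add (by fun_prop)).add (by fun_prop)
  have hφC : ContDiffOn ℝ 2 φ (Qset b) := by
    have : ContDiffOn ℝ 2 (fun q : ℝ × ℝ => S q.1) (Qset b) :=
      hSC.comp contDiff_fst.contDiffOn fun q hq => hq.1
    exact (this.add (ContDiff.contDiffOn (by fun_prop))).add (ContDiff.contDiffOn (by fun_prop))
  set T : ℝ := (|M - c0| + |B1| + 1) / δ + 1 with hT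
  have hT1 : 1 ≤ T := by
    have : 0 ≤ (|M - c0| + |B1| + 1) / δ := by positivity
    linarith
  obtain ⟨r, hrb, hr⟩ := hDinf (2 * (|M - c0| + |B1| * T) / η)
  have hneg : ∀ q ∈ Q0set b, 0 < v q - φ q → q ∈ Icc (-r) r ×ˢ Icc 0 T := by
    intro q hq hpos
    have hq2 : (0:ℝ) ≤ q.2 := hq.2
    have i1 := hMB q hq
    have i2 := hSD q.1 hq.1
    have i3 := hD0 q.1 hq.1
    have i4 : 0 ≤ B * q.2 := by positivity
    have i5 : B1 * q.2 ≤ |B1| * q.2 := mul_le_mul_of_nonneg_right (le_abs_self _) hq2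
    have i6 := le_abs_self (M - c0)
    have i7 : 0 < |M - c0| + |B1| * q.2 - η / 2 * D q.1 - δ * q.2 ^ 2 := by
      simp only [hφ] at hpos
      have : 0 ≤ δ * q.2 := by positivity
      nlinarith
    have i8 : 0 ≤ η / 2 * D q.1 := by positivity
    have i9 : q.2 ≤ T := by
      by_contra hlt
      push Not at hlt
      have j1 : |M - c0| + |B1| + 1 ≤ δ * q.2 := by
        have : (|M - c0| + |B1| + 1) / δ ≤ q.2 := by linarith
        rw [div_le_iff₀ hδ] at this
        linarith
      have j2 : 1 ≤ q.2 := by linarith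
      have j3 : (|M - c0| + |B1| + 1) * q.2 ≤ δ * q.2 * q.2 :=
        mul_le_mul_of_nonneg_right j1 hq2
      have j4 : |M - c0| * 1 ≤ |M - c0| * q.2 := mul_le_mul_of_nonneg_left j2 (abs_nonneg _)
      nlinarith
    refine ⟨hr q.1 hq.1 ?_, hq2, i9⟩
    rw [le_div_iff₀ hη]
    have j1 : |B1| * q.2 ≤ |B1| * T := mul_le_mul_of_nonneg_left i9 (abs_nonneg _)
    have j2 : 0 ≤ δ * q.2 ^ 2 := by positivity
    nlinarith
  have hpv : 0 < v p - φ p := by simp only [hφ]; linarith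
  have hKsub : Icc (-r) r ×ˢ Icc 0 T ⊆ Q0set b := by
    rintro ⟨x, t⟩ ⟨⟨h1, h2⟩, ⟨h3, h4⟩⟩
    simp only at h1 h2 h3 h4
    exact ⟨⟨by linarith, by linarith⟩, h3⟩
  have husc : UpperSemicontinuousOn (fun z => v z + (-φ z)) (Icc (-r) r ×ˢ Icc 0 T) :=
    (hv.1.1.mono hKsub).add ((hφC0.mono hKsub).neg.upperSemicontinuousOn)
  obtain ⟨z, hz, hzmax⟩ := husc.exists_isMaxOn ⟨p, hneg p hp hpv⟩
    (isCompact_Icc.prod isCompact_Icc)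
  have hz0 := hKsub hz
  have hzp : v p + -φ p ≤ v z + -φ z := hzmax (hneg p hp hpv)
  have hglob : ∀ q ∈ Q0set b, v q - φ q ≤ v z - φ z := by
    intro q hq
    by_cases h : 0 < v q - φ q
    · have : v q + -φ q ≤ v z + -φ z := hzmax (hneg q hq h)
      linarith
    · linarith
  have hz2 : 0 < z.2 := by
    rcases (show (0:ℝ) ≤ z.2 from hz0.2).lt_or_eq with h | h
    · exact h
    · exfalso
      have h1 := hv.2.1 z.1 hz0.1
      have h2 := hS0 z.1 hz0.1
      have e : ((z.1, 0) : ℝ × ℝ) = z := by rw [h]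
      rw [e] at h1
      have : φ z = S z.1 := by simp only [hφ]; rw [← h]; ring
      linarith
  have hzQ : z ∈ Qset b := ⟨hz0.1, hz2⟩
  have hloc : IsLocalMaxOn (fun q => v q - φ q) (Qset b) z := by
    filter_upwards [self_mem_nhdsWithin] with q hq
    exact hglob q (Qset_sub b hq)
  have hfin := hv.1.2 φ hφC z hzQ hloc
  have e1 : pT φ z = B + δ * (1 + 2 * z.2) := by
    have h1 : HasDerivAt (fun t : ℝ => S z.1 + B * t + δ * (t + t ^ 2)) (B + δ * (1 + 2 * z.2))
        z.2 := by
      have := (((hasDerivAt_id z.2).const_mul B).const_add (S z.1)).add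
        (((hasDerivAt_id z.2).add ((hasDerivAt_id z.2).pow 2)).const_mul δ)
      exact HasDerivAt.congr_deriv this (by simp)
    exact h1.deriv
  have e2 : ∀ x ∈ Ioo (-b) b, pX φ (x, z.2) = S' x := by
    intro x hx
    exact (((hS1 x hx).add_const (B * z.2)).add_const (δ * (z.2 + z.2 ^ 2))).deriv
  have e3 : pXX φ z = S'' z.1 := by
    refine HasDerivAt.deriv ((hS2 z.1 hz0.1).congr_of_eventuallyEq ?_)
    filter_upwards [isOpen_Ioo.mem_nhds hz0.1] with x hx
    exact e2 x hx
  have e4 : pX φ z = S' z.1 := e2 z.1 hz0.1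
  rw [e1, e3, e4] at hfin
  have := hSB z.1 hz0.1
  have : 0 < δ * (1 + 2 * z.2) := by positivity
  linarith

lemma cls_max {b : ℝ} {f g u0 D : ℝ → ℝ} (hfm : StrictMono f) (hf0 : f 0 = 0)
    (hg0 : ∀ s, 0 < g s) (hD0 : ∀ x ∈ Ioo (-b) b, 0 ≤ D x) {m M : ℝ} {ψ : ℝ × ℝ → ℝ}
    (hψ : ContinuousOn ψ (Q0set b)) (hm : ∀ x ∈ Ioo (-b) b, m ≤ u0 x)
    (hψ0 : ∀ x ∈ Ioo (-b) b, ψ (x, 0) ≤ u0 x) (hM : ∀ p ∈ Q0set b, ψ p ≤ M)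
    (H : ∀ p ∈ Qset b, m < ψ p → ∃ (ψ' : ℝ → ℝ) (a c : ℝ),
      HasDerivAt (fun t => ψ (p.1, t)) a p.2 ∧
      (∀ᶠ x in 𝓝 p.1, HasDerivAt (fun x => ψ (x, p.2)) (ψ' x) x) ∧
      HasDerivAt ψ' c p.1 ∧ a ≤ f (g (ψ' p.1) * c)) :
    Cls b f g u0 D (fun p => max m (ψ p)) ∧
      ContinuousOn (fun p => max m (ψ p)) (Q0set b) := by
  have hc : ContinuousOn (fun p => max m (ψ p)) (Q0set b) := continuousOn_const.sup hψ
  refine ⟨⟨isSubSol_of_touch hfm hg0 hc.upperSemicontinuousOn ?_, ?_, ?_⟩, hc⟩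
  · intro p hp
    by_cases h : m < ψ p
    · obtain ⟨ψ', a, c, h1, h2, h3, h4⟩ := H p hp h
      exact ⟨ψ, ψ', a, c, Eventually.of_forall fun q => le_max_right _ _,
        (max_eq_right h.le).symm, h1, h2, h3, h4⟩
    · refine ⟨fun _ => m, fun _ => 0, 0, 0, Eventually.of_forall fun q => le_max_left _ _,
        (max_eq_left (not_lt.1 h)).symm, hasDerivAt_const _ _,
        Eventually.of_forall fun x => hasDerivAt_const _ _, hasDerivAt_const _ _, ?_⟩
      simp [hf0]
  · intro x hx
    exact max_le (hm x hx) (hψ0 x hx)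
  · intro η hη
    refine ⟨max m M, 0, fun p hp => ?_⟩
    have := mul_nonneg hη.le (hD0 p.1 hp.1)
    have h2 := max_le_max (le_refl m) (hM p hp)
    linarith

lemma bddIoo {b : ℝ} {h : ℝ → ℝ} (hb : 0 < b) (hc : ContinuousOn h (Ioo (-b) b)) {K1 K2 : ℝ}
    (h1 : ∀ᶠ x in 𝓝[<] b, h x ≤ K1) (h2 : ∀ᶠ x in 𝓝[>] (-b), h x ≤ K2) :
    ∃ M, ∀ x ∈ Ioo (-b) b, h x ≤ M := by
  obtain ⟨l, hl, hl'⟩ := (mem_nhdsLT_iff_exists_Ioo_subset' (show 0 < b from hb)).1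
    h1
  obtain ⟨r, hr, hr'⟩ := (mem_nhdsGT_iff_exists_Ioo_subset' (show -b < 0 by linarith)).1
    h2
  simp only [mem_Iio, mem_Ioi] at hl hr
  have hsub : Icc r l ⊆ Ioo (-b) b := fun x hx => ⟨lt_of_lt_of_le hr hx.1, lt_of_le_of_lt hx.2 hl⟩
  obtain ⟨M, hM⟩ := isCompact_Icc.bddAbove_image (hc.mono hsub)
  refine ⟨max M (max K1 K2), fun x hx => ?_⟩
  by_cases c1 : l < x
  · have : h x ≤ K1 := hl' ⟨c1, hx.2⟩
    exact this.trans ((le_max_left _ _).trans (le_max_right _ _))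
  · by_cases c2 : x < r
    · have : h x ≤ K2 := hr' ⟨hx.1, c2⟩
      exact this.trans ((le_max_right _ _).trans (le_max_right _ _))
    · exact (hM ⟨x, ⟨not_lt.1 c2, not_lt.1 c1⟩, rfl⟩).trans (le_max_left _ _)

lemma quadBound {b : ℝ} {h : ℝ → ℝ} (hc : ContinuousOn h (Ioo (-b) b)) {M x0 : ℝ}
    (hM : ∀ x ∈ Ioo (-b) b, h x ≤ M) (hx0 : x0 ∈ Ioo (-b) b) (h0 : h x0 ≤ 0) {ε : ℝ}
    (hε : 0 < ε) : ∃ A : ℝ, 0 ≤ A ∧ ∀ x ∈ Ioo (-b) b, h x ≤ ε + A * (x - x0) ^ 2 := by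
  have hca : ContinuousAt h x0 := hc.continuousAt (isOpen_Ioo.mem_nhds hx0)
  obtain ⟨δ, hδ, hd⟩ := Metric.eventually_nhds_iff.1
    (hca.eventually (gt_mem_nhds (show h x0 < ε by linarith)))
  refine ⟨|M| / δ ^ 2, by positivity, fun x hx => ?_⟩
  by_cases hxd : dist x x0 < δ
  · have := hd hxd
    have : 0 ≤ |M| / δ ^ 2 * (x - x0) ^ 2 := by positivity
    linarith
  · have h1 : δ ^ 2 ≤ (x - x0) ^ 2 := by
      rw [Real.dist_eq] at hxd
      rw [← sq_abs (x - x0)]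
      exact pow_le_pow_left₀ hδ.le (not_lt.1 hxd) 2
    have h2 : |M| ≤ |M| / δ ^ 2 * (x - x0) ^ 2 := by
      rw [div_mul_eq_mul_div, le_div_iff₀ (by positivity)]
      exact mul_le_mul_of_nonneg_left h1 (abs_nonneg _)
    have := hM x hx
    have := le_abs_self M
    linarith
/-- One-sided singular profile. -/
def ee (b σ x : ℝ) : ℝ := (b - σ * x)⁻¹

/-- Singular profile. -/
def DD (b : ℝ) (N : ℕ) (x : ℝ) : ℝ := ee b 1 x ^ N + ee b (-1) x ^ N

lemma ee_den {b σ x : ℝ} (hσ : σ = 1 ∨ σ = -1) (hx : x ∈ Ioo (-b) b) : 0 < b - σ * x := by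
  rcases hσ with rfl | rfl <;> linarith [hx.1, hx.2]

lemma ee_pos {b σ x : ℝ} (hσ : σ = 1 ∨ σ = -1) (hx : x ∈ Ioo (-b) b) : 0 < ee b σ x :=
  inv_pos.2 (ee_den hσ hx)

lemma ee_deriv {b σ x : ℝ} (h : 0 < b - σ * x) (N : ℕ) :
    HasDerivAt (fun x => ee b σ x ^ N) (σ * N * ee b σ x ^ (N + 1)) x := by
  have h1 : HasDerivAt (fun x => b - σ * x) (-σ) x := by
    simpa using ((hasDerivAt_id x).const_mul σ).const_sub b
  have h2 := (h1.fun_inv h.ne').pow N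
  refine HasDerivAt.congr_deriv h2 ?_
  unfold ee
  rcases N with _ | k
  · simp
  · simp only [Nat.add_sub_cancel, neg_neg, div_eq_mul_inv, ← inv_pow]
    ring

lemma ee_C2 {b σ : ℝ} (hσ : σ = 1 ∨ σ = -1) (N : ℕ) :
    ContDiffOn ℝ 2 (fun x => ee b σ x ^ N) (Ioo (-b) b) := by
  unfold ee
  refine ContDiffOn.pow (ContDiffOn.inv (ContDiff.contDiffOn (by fun_prop)) ?_) N
  intro x hx
  exact (ee_den hσ hx).ne'

lemma DD_C2 (b : ℝ) (N : ℕ) : ContDiffOn ℝ 2 (DD b N) (Ioo (-b) b) :=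
  (ee_C2 (Or.inl rfl) N).add (ee_C2 (Or.inr rfl) N)

lemma DD_nonneg {b : ℝ} (N : ℕ) : ∀ x ∈ Ioo (-b) b, 0 ≤ DD b N x := fun _ hx =>
  add_nonneg (pow_nonneg (ee_pos (Or.inl rfl) hx).le N) (pow_nonneg (ee_pos (Or.inr rfl) hx).le N)

lemma DD_inf {b : ℝ} {N : ℕ} (hN : 1 ≤ N) (R : ℝ) :
    ∃ r : ℝ, r < b ∧ ∀ x ∈ Ioo (-b) b, DD b N x ≤ R → x ∈ Icc (-r) r := by
  set R' := max R 1 with hR'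
  have hR1 : 1 ≤ R' := le_max_right _ _
  have hpos : 0 < R'⁻¹ := inv_pos.2 (by linarith)
  refine ⟨b - R'⁻¹, by linarith, fun x hx hD => ?_⟩
  have key : ∀ σ : ℝ, (σ = 1 ∨ σ = -1) → σ * x ≤ b - R'⁻¹ := by
    intro σ hσ
    have h1 := ee_pos hσ hx
    have h2 : ee b σ x ^ N ≤ R' := by
      have a1 := pow_nonneg (ee_pos (b := b) (Or.inl rfl) hx).le N
      have a2 := pow_nonneg (ee_pos (b := b) (Or.inr rfl) hx).le N
      have a3 := le_max_left R 1
      unfold DD at hD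
      rcases hσ with rfl | rfl <;> linarith
    have h3 : ee b σ x ≤ R' := by
      by_contra hlt
      push Not at hlt
      have : ee b σ x ≤ ee b σ x ^ N := le_self_pow₀ (by linarith) (by omega)
      linarith
    have h4 : R'⁻¹ ≤ (ee b σ x)⁻¹ := inv_anti₀ h1 h3
    unfold ee at h4
    rw [inv_inv] at h4
    linarith
  have k1 := key 1 (Or.inl rfl)
  have k2 := key (-1) (Or.inr rfl)
  constructor <;> linarith

lemma g_upper {g : ℝ → ℝ} {α : ℝ} (hα : 1 < α) (hg : A2 g α) :
    ∃ C : ℝ, 0 < C ∧ ∀ p, g p * (1 + |p|) ^ α ≤ C := by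
  obtain ⟨hgc, hg0, Cp, Cm, hCp, hCm, h1, h2⟩ := hg
  have hc : Continuous (fun p => g p * (1 + |p|) ^ α) := by
    refine hgc.mul (Continuous.rpow_const (by fun_prop) ?_)
    intro p; left; positivity
  have key : ∀ p K, 1 ≤ |p| → |p| ^ α * g p < K → g p * (1 + |p|) ^ α ≤ 2 ^ α * K := by
    intro p K hp hK
    have a1 : (1 + |p|) ^ α ≤ (2 * |p|) ^ α :=
      Real.rpow_le_rpow (by positivity) (by linarith) (by linarith)
    rw [Real.mul_rpow (by norm_num) (abs_nonneg _)] at a1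
    calc g p * (1 + |p|) ^ α ≤ g p * (2 ^ α * |p| ^ α) :=
          mul_le_mul_of_nonneg_left a1 (hg0 p).le
      _ = 2 ^ α * (|p| ^ α * g p) := by ring
      _ ≤ 2 ^ α * K := by gcongr
  obtain ⟨s1, hs1⟩ := eventually_atTop.1 ((h1.eventually (gt_mem_nhds (lt_add_one Cp))).and
    (eventually_ge_atTop 1))
  obtain ⟨s2, hs2⟩ := eventually_atBot.1 ((h2.eventually (gt_mem_nhds (lt_add_one Cm))).and
    (eventually_le_atBot (-1)))
  obtain ⟨M, hM⟩ := (isCompact_Icc (a := s2) (b := s1)).bddAbove_image hc.continuousOn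
  refine ⟨max (max M 1) (max (2 ^ α * (Cp + 1)) (2 ^ α * (Cm + 1))), by positivity, fun p => ?_⟩
  by_cases c1 : s1 ≤ p
  · have := hs1 p c1
    exact (key p _ (this.2.trans (le_abs_self p)) this.1).trans
      ((le_max_left _ _).trans (le_max_right _ _))
  · by_cases c2 : p ≤ s2
    · have := hs2 p c2
      exact (key p _ (by linarith [neg_le_abs p]) this.1).trans
        ((le_max_right _ _).trans (le_max_right _ _))
    · exact (hM ⟨p, ⟨(not_le.1 c2).le, (not_le.1 c1).le⟩, rfl⟩).trans
        ((le_max_left _ _).trans (le_max_left _ _))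

lemma g_lower {g : ℝ → ℝ} {α : ℝ} (hg : A2 g α) :
    ∃ c s0 : ℝ, 0 < c ∧ 0 < s0 ∧ ∀ s ≥ s0, ∀ σ : ℝ, (σ = 1 ∨ σ = -1) →
      c * s ^ (-α) ≤ g (σ * s) := by
  obtain ⟨hgc, hg0, Cp, Cm, hCp, hCm, h1, h2⟩ := hg
  obtain ⟨s1, hs1⟩ := eventually_atTop.1 (h1.eventually (lt_mem_nhds (half_lt_self hCp)))
  obtain ⟨s2, hs2⟩ := eventually_atBot.1 (h2.eventually (lt_mem_nhds (half_lt_self hCm)))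
  refine ⟨min (Cp / 2) (Cm / 2), max 1 (max s1 (-s2)), by positivity, by positivity, ?_⟩
  intro s hs σ hσ
  have a1 : 1 ≤ s := (le_max_left _ _).trans hs
  have a2 : s1 ≤ s := ((le_max_left _ _).trans (le_max_right _ _)).trans hs
  have a3 : -s2 ≤ s := ((le_max_right _ _).trans (le_max_right _ _)).trans hs
  have hs0 : 0 < s := by linarith
  have hpow : 0 < s ^ α := Real.rpow_pos_of_pos hs0 α
  rw [Real.rpow_neg hs0.le, ← div_eq_mul_inv, div_le_iff₀ hpow]
  rcases hσ with rfl | rfl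
  · have := hs1 s a2
    rw [abs_of_pos hs0] at this
    have := min_le_left (Cp / 2) (Cm / 2)
    rw [one_mul]; linarith
  · have := hs2 (-s) (by linarith)
    rw [abs_neg, abs_of_pos hs0] at this
    have := min_le_right (Cp / 2) (Cm / 2)
    rw [neg_one_mul]; linarith

/-- Core bound for super-solutions. -/
lemma core_bound {g : ℝ → ℝ} {α Cg s1 a k k2 : ℝ} {N : ℕ} (hg0 : ∀ s, 0 < g s)
    (hCg : ∀ p, g p * (1 + |p|) ^ α ≤ Cg) (hα : 1 < α) (hN : (N : ℝ) + 2 ≤ (N + 1) * α)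
    (hs1 : 0 < s1) (ha : 0 < a) (hk : 0 ≤ k) (hk2 : 0 ≤ k2) :
    ∃ C : ℝ, ∀ s p z : ℝ, s1 ≤ s → a * s ^ (N + 1) ≤ |p| + k → z ≤ k2 * s ^ (N + 2) →
      g p * z ≤ C := by
  set θ : ℝ := (N + 1) * α - (N + 2) with hθ
  have hθ0 : 0 ≤ θ := by linarith
  refine ⟨k2 * (s1 ^ θ)⁻¹ * ((1 + k) / a) ^ α * Cg, fun s p z hs h1 h2 => ?_⟩
  have hs0 : 0 < s := by linarith
  have hgp := (hg0 p).le
  have e1 : s ^ (N + 1) ≤ (1 + k) / a * (1 + |p|) := by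
    rw [div_mul_eq_mul_div, le_div_iff₀ ha]
    have := mul_nonneg hk (abs_nonneg p)
    nlinarith
  have e2 : (s ^ (N + 1)) ^ α ≤ ((1 + k) / a) ^ α * (1 + |p|) ^ α := by
    rw [← Real.mul_rpow (by positivity) (by positivity)]
    exact Real.rpow_le_rpow (by positivity) e1 (by linarith)
  have e3 : (s ^ (N + 1)) ^ α = s ^ (N + 2) * s ^ θ := by
    rw [← Real.rpow_natCast s (N + 1), ← Real.rpow_natCast s (N + 2), ← Real.rpow_mul hs0.le,
      ← Real.rpow_add hs0]
    congr 1
    rw [hθ]; push_cast; ring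
  have e4 : s1 ^ θ ≤ s ^ θ := Real.rpow_le_rpow hs1.le hs hθ0
  have hs1θ : 0 < s1 ^ θ := Real.rpow_pos_of_pos hs1 θ
  have e5 : s ^ (N + 2) ≤ (s1 ^ θ)⁻¹ * (((1 + k) / a) ^ α * (1 + |p|) ^ α) := by
    rw [inv_mul_eq_div, le_div_iff₀ hs1θ]
    refine le_trans ?_ e2
    rw [e3]
    gcongr
  calc g p * z ≤ g p * (k2 * s ^ (N + 2)) := mul_le_mul_of_nonneg_left h2 hgp
    _ ≤ g p * (k2 * ((s1 ^ θ)⁻¹ * (((1 + k) / a) ^ α * (1 + |p|) ^ α))) := by gcongr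
    _ = k2 * (s1 ^ θ)⁻¹ * ((1 + k) / a) ^ α * (g p * (1 + |p|) ^ α) := by ring
    _ ≤ k2 * (s1 ^ θ)⁻¹ * ((1 + k) / a) ^ α * Cg := by
        gcongr
        exact hCg p

lemma sup_bound {b α : ℝ} {g : ℝ → ℝ} {N : ℕ} (hb : 0 < b) (hα : 1 < α) (hg : A2 g α)
    (hN1 : 1 ≤ N) (hN : (N : ℝ) + 2 ≤ (N + 1) * α) {A η x0 : ℝ} (hA : 0 ≤ A) (hη : 0 < η)
    (hx0 : x0 ∈ Ioo (-b) b) :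
    ∃ C : ℝ, ∀ x ∈ Ioo (-b) b,
      g (2 * A * (x - x0) + η * (N * ee b 1 x ^ (N + 1) - N * ee b (-1) x ^ (N + 1))) *
        (2 * A + η * (N * (N + 1) * (ee b 1 x ^ (N + 2) + ee b (-1) x ^ (N + 2)))) ≤ C := by
  obtain ⟨Cg, -, hCg⟩ := g_upper hα hg
  have hNr : (1:ℝ) ≤ N := by exact_mod_cast hN1
  have hNpos : (0:ℝ) < N := by linarith
  set k : ℝ := η * N * (b⁻¹) ^ (N + 1) + 2 * A * (2 * b) with hk
  set k2 : ℝ := 2 * A * b ^ (N + 2) + 2 * (η * (N * (N + 1))) with hk2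
  obtain ⟨C, hC⟩ := core_bound (s1 := b⁻¹) (a := η * N) (k := k) (k2 := k2) hg.2.1 hCg hα hN
    (by positivity) (by positivity) (by positivity) (by positivity)
  have est : ∀ s s' : ℝ, b⁻¹ ≤ s → 0 ≤ s' → s' ≤ b⁻¹ →
      2 * A + η * (N * (N + 1) * (s ^ (N + 2) + s' ^ (N + 2))) ≤ k2 * s ^ (N + 2) ∧
      η * (N * s' ^ (N + 1)) ≤ η * N * (b⁻¹) ^ (N + 1) := by
    intro s s' h1 h2 h3
    have hbi : 0 < b⁻¹ := by positivity
    have i1 : s' ^ (N + 2) ≤ s ^ (N + 2) := pow_le_pow_left₀ h2 (h3.trans h1) _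
    have i2 : 1 ≤ b ^ (N + 2) * s ^ (N + 2) := by
      rw [← mul_pow]
      apply one_le_pow₀
      calc 1 = b * b⁻¹ := by field_simp
        _ ≤ b * s := by gcongr
    have i3 : 2 * A * 1 ≤ 2 * A * (b ^ (N + 2) * s ^ (N + 2)) :=
      mul_le_mul_of_nonneg_left i2 (by positivity)
    have i4 : η * (N * (N + 1)) * s' ^ (N + 2) ≤ η * (N * (N + 1)) * s ^ (N + 2) :=
      mul_le_mul_of_nonneg_left i1 (by positivity)
    have i5 : s' ^ (N + 1) ≤ (b⁻¹) ^ (N + 1) := pow_le_pow_left₀ h2 h3 _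
    have i6 : η * N * s' ^ (N + 1) ≤ η * N * (b⁻¹) ^ (N + 1) :=
      mul_le_mul_of_nonneg_left i5 (by positivity)
    constructor
    · rw [hk2]; nlinarith
    · linarith
  refine ⟨C, fun x hx => ?_⟩
  have p1 := ee_pos (b := b) (Or.inl rfl) hx
  have p2 := ee_pos (b := b) (Or.inr rfl) hx
  have hAx : |2 * A * (x - x0)| ≤ 2 * A * (2 * b) := by
    rw [abs_mul, abs_of_nonneg (by positivity : 0 ≤ 2 * A)]
    refine mul_le_mul_of_nonneg_left ?_ (by positivity)
    rw [abs_le]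
    constructor <;> linarith [hx.1, hx.2, hx0.1, hx0.2]
  have hAx' := abs_le.1 hAx
  have d1 := ee_den (b := b) (Or.inl rfl) hx
  have d2 := ee_den (b := b) (Or.inr rfl) hx
  rcases le_total 0 x with h | h
  · have q1 : b⁻¹ ≤ ee b 1 x := inv_anti₀ d1 (by linarith)
    have q2 : ee b (-1) x ≤ b⁻¹ := inv_anti₀ hb (by linarith)
    obtain ⟨r1, r2⟩ := est _ _ q1 p2.le q2
    refine hC (ee b 1 x) _ _ q1 ?_ r1
    have := le_abs_self (2 * A * (x - x0) +
      η * (N * ee b 1 x ^ (N + 1) - N * ee b (-1) x ^ (N + 1)))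
    rw [hk]; linarith
  · have q1 : b⁻¹ ≤ ee b (-1) x := inv_anti₀ d2 (by linarith)
    have q2 : ee b 1 x ≤ b⁻¹ := inv_anti₀ hb (by linarith)
    obtain ⟨r1, r2⟩ := est _ _ q1 p1.le q2
    refine hC (ee b (-1) x) _ _ q1 ?_ (by rw [add_comm (ee b 1 x ^ (N + 2))]; exact r1)
    have := neg_le_abs (2 * A * (x - x0) +
      η * (N * ee b 1 x ^ (N + 1) - N * ee b (-1) x ^ (N + 1)))
    rw [hk]; linarith
lemma upper {b α : ℝ} {f g u0 : ℝ → ℝ} {N : ℕ} (hb : 0 < b) (hf : A1 f) (hα : 1 < α)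
    (hg : A2 g α) (hN1 : 1 ≤ N) (hN : (N : ℝ) + 2 ≤ (N + 1) * α)
    (hu0 : ContinuousOn u0 (Ioo (-b) b))
    (hgr : ∀ η : ℝ, 0 < η → ∃ M, ∀ x ∈ Ioo (-b) b, u0 x ≤ M + η * DD b N x)
    {x0 : ℝ} (hx0 : x0 ∈ Ioo (-b) b) {ε η : ℝ} (hε : 0 < ε) (hη : 0 < η) :
    ∃ A B : ℝ, 0 ≤ A ∧ 0 ≤ B ∧ ∀ v, Cls b f g u0 (DD b N) v → ∀ p ∈ Q0set b,
      v p ≤ u0 x0 + ε + A * (p.1 - x0) ^ 2 + η * DD b N p.1 + B * p.2 := by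
  obtain ⟨M, hM⟩ := hgr η hη
  obtain ⟨A, hA, hAx⟩ := quadBound (h := fun x => u0 x - η * DD b N x - u0 x0)
    ((hu0.sub (continuousOn_const.mul (DD_C2 b N).continuousOn)).sub continuousOn_const)
    (M := M - u0 x0) (fun x hx => by have := hM x hx; linarith) hx0
    (by have := mul_nonneg hη.le (DD_nonneg N x0 hx0); linarith) hε
  obtain ⟨C, hC⟩ := sup_bound hb hα hg hN1 hN hA hη hx0
  refine ⟨A, max (f C) 0, hA, le_max_right _ _, fun v hv p hp => ?_⟩
  refine comparison (S := fun x => u0 x0 + ε + A * (x - x0) ^ 2 + η * DD b N x)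
    (S' := fun x => 2 * A * (x - x0) + η * (N * ee b 1 x ^ (N + 1) - N * ee b (-1) x ^ (N + 1)))
    (S'' := fun x => 2 * A + η * (N * (N + 1) * (ee b 1 x ^ (N + 2) + ee b (-1) x ^ (N + 2))))
    (c0 := u0 x0) hη (le_max_right _ _) (DD_nonneg N) (DD_inf hN1) ?_ ?_ ?_ ?_ ?_ ?_ hv hp
  · exact (ContDiff.contDiffOn (by fun_prop)).add (contDiffOn_const.mul (DD_C2 b N))
  · intro x hx
    have h1 := ee_deriv (ee_den (b := b) (Or.inl rfl) hx) N
    have h2 := ee_deriv (ee_den (b := b) (Or.inr rfl) hx) N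
    have h3 := (((((hasDerivAt_id x).sub_const x0).pow 2).const_mul A).const_add (u0 x0 + ε)).add
      ((h1.add h2).const_mul η)
    refine HasDerivAt.congr_deriv h3 ?_
    simp; ring
  · intro x hx
    have h1 := ee_deriv (ee_den (b := b) (Or.inl rfl) hx) (N + 1)
    have h2 := ee_deriv (ee_den (b := b) (Or.inr rfl) hx) (N + 1)
    have h3 := (((hasDerivAt_id x).sub_const x0).const_mul (2 * A)).add
      (((h1.const_mul (N : ℝ)).sub (h2.const_mul (N : ℝ))).const_mul η)
    refine HasDerivAt.congr_deriv h3 ?_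
    push_cast; ring
  · intro x hx
    exact (hf.2.1.monotone (hC x hx)).trans (le_max_left _ _)
  · intro x hx
    have := hAx x hx
    linarith
  · intro x hx
    have : 0 ≤ A * (x - x0) ^ 2 := by positivity
    linarith

lemma lower {b α : ℝ} {f g u0 D : ℝ → ℝ} (hf : A1 f) (hα : 1 < α)
    (hg : A2 g α) (hD0 : ∀ x ∈ Ioo (-b) b, 0 ≤ D x)
    (hu0 : ContinuousOn u0 (Ioo (-b) b)) {m : ℝ} (hm : ∀ x ∈ Ioo (-b) b, m ≤ u0 x)
    {x0 : ℝ} (hx0 : x0 ∈ Ioo (-b) b) {ε : ℝ} (hε : 0 < ε) :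
    ∃ v : ℝ × ℝ → ℝ, Cls b f g u0 D v ∧ ContinuousOn v (Q0set b) ∧ u0 x0 - ε ≤ v (x0, 0) := by
  obtain ⟨A, hA, hAx⟩ := quadBound (h := fun x => u0 x0 - u0 x)
    (continuousOn_const.sub hu0) (M := u0 x0 - m) (fun x hx => by have := hm x hx; linarith) hx0
    (by simp) hε
  obtain ⟨Cg, hCg0, hCg⟩ := g_upper hα hg
  have hgC : ∀ p, g p ≤ Cg := by
    intro p
    have h1 : 1 ≤ (1 + |p|) ^ α := Real.one_le_rpow (by linarith [abs_nonneg p]) (by linarith)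
    have h2 : g p * 1 ≤ g p * (1 + |p|) ^ α := mul_le_mul_of_nonneg_left h1 (hg.2.1 p).le
    linarith [hCg p]
  set B : ℝ := -f (Cg * (-2 * A)) with hB
  have hB0 : 0 ≤ B := by
    have h1 : Cg * (-2 * A) ≤ 0 := by nlinarith
    have := hf.2.1.monotone h1
    rw [hf.2.2.1] at this
    linarith
  set ψ : ℝ × ℝ → ℝ := fun p => u0 x0 - ε - A * (p.1 - x0) ^ 2 - B * p.2 with hψ
  obtain ⟨h1, h2⟩ := cls_max (D := D) (u0 := u0) (m := m) (M := u0 x0 - ε) (ψ := ψ) (f := f)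
    (g := g) (b := b) hf.2.1 hf.2.2.1 hg.2.1 hD0
    (by simp only [hψ]; fun_prop) hm
    (by
      intro x hx
      have := hAx x hx
      simp only [hψ] at this ⊢
      linarith)
    (by
      intro p hp
      have i1 : 0 ≤ A * (p.1 - x0) ^ 2 := by positivity
      have i2 : 0 ≤ B * p.2 := mul_nonneg hB0 hp.2
      simp only [hψ]; linarith)
    (by
      intro p hp _
      refine ⟨fun x => -2 * A * (x - x0), -B, -2 * A, ?_, ?_, ?_, ?_⟩
      · have := ((hasDerivAt_id p.2).const_mul B).const_sub (u0 x0 - ε - A * (p.1 - x0) ^ 2)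
        exact HasDerivAt.congr_deriv this (by simp)
      · refine Eventually.of_forall fun x => ?_
        have := (((((hasDerivAt_id x).sub_const x0).pow 2).const_mul A).const_sub
          (u0 x0 - ε)).sub_const (B * p.2)
        refine HasDerivAt.congr_deriv this ?_
        simp; ring
      · have := ((hasDerivAt_id p.1).sub_const x0).const_mul (-2 * A)
        exact HasDerivAt.congr_deriv this (by simp)
      · rw [hB, neg_neg]
        refine hf.2.1.monotone ?_
        have := hgC (-2 * A * (p.1 - x0))
        nlinarith)
  refine ⟨_, h1, h2, ?_⟩
  refine le_trans ?_ (le_max_right _ _)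
  simp [hψ]

lemma boundary {b α : ℝ} {f g u0 D : ℝ → ℝ} (hf : A1 f) (hα : 1 < α) (hα2 : α ≤ 2)
    (hg : A2 g α) (hD0 : ∀ x ∈ Ioo (-b) b, 0 ≤ D x)
    {m : ℝ} (hm : ∀ x ∈ Ioo (-b) b, m ≤ u0 x) {σ : ℝ} (hσ : σ = 1 ∨ σ = -1)
    {t : ℝ} (ht : 0 < t) (M : ℝ) :
    ∃ v : ℝ × ℝ → ℝ, Cls b f g u0 D v ∧ ContinuousOn v (Q0set b) ∧
      ∀ᶠ x in 𝓝 (σ * b), M ≤ v (x, t) := by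
  have hσ2 : σ * σ = 1 := by rcases hσ with rfl | rfl <;> norm_num
  have hexp : Real.exp (-t) < 1 := by rw [Real.exp_lt_one_iff]; linarith
  obtain ⟨L, hL0, hL⟩ : ∃ L : ℝ, 0 < L ∧ M < m + L * (1 - Real.exp (-t)) := by
    have h1 : 0 < 1 - Real.exp (-t) := by linarith
    refine ⟨(|M - m| + 1) / (1 - Real.exp (-t)), by positivity, ?_⟩
    rw [div_mul_cancel₀ _ h1.ne']
    linarith [le_abs_self (M - m)]
  obtain ⟨K, hKL, hK0⟩ := ((hf.2.2.2.1.eventually (eventually_ge_atTop L)).and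
    (eventually_gt_atTop 0)).exists
  obtain ⟨c, s0, hc, hs0, hgl⟩ := g_lower hg
  obtain ⟨A, hA, hAK⟩ : ∃ A : ℝ, 0 < A ∧ A ^ (1 - α) = K / c := by
    refine ⟨(K / c) ^ (1 - α)⁻¹, by positivity, ?_⟩
    rw [← Real.rpow_mul (by positivity), inv_mul_cancel₀ (by linarith), Real.rpow_one]
  set ρ : ℝ := min 1 (A / s0) with hρ
  have hρ0 : 0 < ρ := by positivity
  set δ : ℝ := ρ * Real.exp (-(L / A)) with hδ
  have hδ0 : 0 < δ := by positivity
  have hlogδ : A * (Real.log ρ - Real.log δ) = L := by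
    rw [hδ, Real.log_mul hρ0.ne' (Real.exp_pos _).ne', Real.log_exp]
    field_simp; ring
  set ψ : ℝ × ℝ → ℝ := fun p =>
    m + A * (Real.log ρ - Real.log (b + δ - σ * p.1)) - L * Real.exp (-p.2) with hψ
  have hd : ∀ x ∈ Ioo (-b) b, δ < b + δ - σ * x := fun x hx => by
    have := ee_den hσ hx; linarith
  have hWL : ∀ x ∈ Ioo (-b) b, A * (Real.log ρ - Real.log (b + δ - σ * x)) ≤ L := by
    intro x hx
    rw [← hlogδ]
    have := Real.log_le_log hδ0 (hd x hx).le
    exact mul_le_mul_of_nonneg_left (by linarith) hA.le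
  obtain ⟨h1, h2⟩ := cls_max (D := D) (u0 := u0) (m := m) (M := m + L) (ψ := ψ) (f := f)
    (g := g) (b := b) hf.2.1 hf.2.2.1 hg.2.1 hD0
    (by
      simp only [hψ]
      have : ContinuousOn (fun p : ℝ × ℝ => Real.log (b + δ - σ * p.1)) (Q0set b) := by
        refine ContinuousOn.log (by fun_prop) fun p hp => ?_
        have := hd p.1 hp.1
        exact (hδ0.trans this).ne'
      exact (continuousOn_const.add (continuousOn_const.mul (continuousOn_const.sub this))).sub
        (by fun_prop)) hm
    (by
      intro x hx
      have := hWL x hx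
      have := hm x hx
      simp only [hψ, neg_zero, Real.exp_zero]
      linarith)
    (by
      intro p hp
      have := hWL p.1 hp.1
      have : 0 < L * Real.exp (-p.2) := by positivity
      simp only [hψ]; linarith)
    (by
      intro p hp hpos
      have hdp := hd p.1 hp.1
      have hderlog : ∀ x ∈ Ioo (-b) b, HasDerivAt (fun x => b + δ - σ * x) (-σ) x := by
        intro x _
        simpa using ((hasDerivAt_id x).const_mul σ).const_sub (b + δ)
      refine ⟨fun x => σ * (A * (b + δ - σ * x)⁻¹), L * Real.exp (-p.2),
        A * ((b + δ - σ * p.1)⁻¹) ^ 2, ?_, ?_, ?_, ?_⟩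
      · have h3 : HasDerivAt (fun t : ℝ => Real.exp (-t)) (-Real.exp (-p.2)) p.2 := by
          simpa using (hasDerivAt_neg p.2).exp
        have := (h3.const_mul L).const_sub
          (m + A * (Real.log ρ - Real.log (b + δ - σ * p.1)))
        exact HasDerivAt.congr_deriv this (by simp)
      · filter_upwards [isOpen_Ioo.mem_nhds hp.1] with x hx
        have h3 := (hderlog x hx).log (hδ0.trans (hd x hx)).ne'
        have := (((h3.const_sub (Real.log ρ)).const_mul A).const_add m).sub_const
          (L * Real.exp (-p.2))
        refine HasDerivAt.congr_deriv this ?_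
        rw [neg_div, neg_neg, div_eq_mul_inv]; ring
      · have h3 := (hderlog p.1 hp.1).fun_inv (hδ0.trans hdp).ne'
        have := (h3.const_mul A).const_mul σ
        refine HasDerivAt.congr_deriv this ?_
        rw [neg_neg, div_eq_mul_inv, inv_pow]
        linear_combination (A * ((b + δ - σ * p.1) ^ 2)⁻¹) * hσ2
      · have hp2 : (0:ℝ) < p.2 := hp.2
        have hle1 : Real.exp (-p.2) ≤ 1 := by rw [Real.exp_le_one_iff]; linarith
        set d : ℝ := b + δ - σ * p.1 with hdd
        have hd0 : 0 < d := hδ0.trans hdp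
        have hdρ : d < ρ := by
          have h3 : 0 < A * (Real.log ρ - Real.log d) := by
            have : 0 < L * Real.exp (-p.2) := by positivity
            simp only [hψ] at hpos
            linarith
          have h4 : 0 < Real.log ρ - Real.log d := pos_of_mul_pos_right h3 hA.le
          exact (Real.log_lt_log_iff hd0 hρ0).1 (by linarith)
        have hd1 : d ≤ 1 := hdρ.le.trans (min_le_left _ _)
        have hds : s0 ≤ A * d⁻¹ := by
          have : d ≤ A / s0 := hdρ.le.trans (min_le_right _ _)
          rw [le_div_iff₀ hs0] at this
          rw [← div_eq_mul_inv, le_div_iff₀ hd0]; linarith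
        have h5 := hgl _ hds σ hσ
        have h6 : K ≤ g (σ * (A * d⁻¹)) * (A * d⁻¹ ^ 2) := by
          have hAd : c * (A * d⁻¹) ^ (-α) * (A * d⁻¹ ^ 2) = K * d ^ (α - 2) := by
            rw [Real.mul_rpow hA.le (by positivity), Real.inv_rpow hd0.le, Real.rpow_neg hd0.le,
              inv_inv]
            have e1 : A ^ (-α) * A = K / c := by
              rw [← hAK, show 1 - α = -α + 1 by ring, Real.rpow_add_one hA.ne']
            have e2 : d ^ α * d⁻¹ ^ 2 = d ^ (α - 2) := by
              rw [Real.rpow_sub hd0, inv_pow, div_eq_mul_inv]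
              norm_num
            calc c * (A ^ (-α) * d ^ α) * (A * d⁻¹ ^ 2)
                = c * (A ^ (-α) * A) * (d ^ α * d⁻¹ ^ 2) := by ring
              _ = K * d ^ (α - 2) := by rw [e1, e2]; field_simp
          have h7 : 1 ≤ d ^ (α - 2) :=
            Real.one_le_rpow_of_pos_of_le_one_of_nonpos hd0 hd1 (by linarith)
          calc K = K * 1 := by ring
            _ ≤ K * d ^ (α - 2) := by gcongr
            _ = c * (A * d⁻¹) ^ (-α) * (A * d⁻¹ ^ 2) := hAd.symm
            _ ≤ _ := by gcongr
        calc L * Real.exp (-p.2) ≤ L * 1 := by gcongr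
          _ = L := mul_one L
          _ ≤ f K := hKL
          _ ≤ _ := hf.2.1.monotone h6)
  refine ⟨_, h1, h2, ?_⟩
  have hcont : ContinuousAt (fun x : ℝ => ψ (x, t)) (σ * b) := by
    simp only [hψ]
    have h3 : ContinuousAt (fun x : ℝ => Real.log (b + δ - σ * x)) (σ * b) := by
      refine ContinuousAt.log (by fun_prop) ?_
      have : b + δ - σ * (σ * b) = δ := by linear_combination (-b) * hσ2
      rw [this]; exact hδ0.ne'
    exact ((h3.const_sub (Real.log ρ)).const_mul A |>.const_add m).sub continuousAt_const
  have hval : M < ψ (σ * b, t) := by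
    have : b + δ - σ * (σ * b) = δ := by linear_combination (-b) * hσ2
    simp only [hψ]
    rw [this, hlogδ]; linarith
  filter_upwards [hcont.eventually (lt_mem_nhds hval)] with x hx
  exact hx.le.trans (le_max_right _ _)

lemma pow_growth {u s γ C η : ℝ} {N : ℕ} (hs : 0 < s) (h : u * s ^ γ ≤ C)
    (h2 : s ^ ((N : ℝ) - γ) * C ≤ η) : u ≤ η * (s⁻¹) ^ N := by
  have h3 : s ^ N = s ^ γ * s ^ ((N : ℝ) - γ) := by
    rw [← Real.rpow_add hs, ← Real.rpow_natCast]; congr 1; ring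
  have h4 : u * s ^ N ≤ η := by
    rw [h3, ← mul_assoc]
    have h5 := mul_le_mul_of_nonneg_right h (Real.rpow_nonneg hs.le ((N : ℝ) - γ))
    linarith
  rw [inv_pow, ← div_eq_mul_inv, le_div_iff₀ (pow_pos hs N)]
  exact h4

lemma ev_small {l : Filter ℝ} {s : ℝ → ℝ} {δ C η : ℝ} (hδ : 0 < δ) (hη : 0 < η)
    (hs : Tendsto s l (𝓝 0)) : ∀ᶠ x in l, s x ^ δ * C ≤ η := by
  have h1 : Tendsto (fun x => s x ^ δ * C) l (𝓝 (0 ^ δ * C)) :=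
    ((Real.continuousAt_rpow_const 0 δ (Or.inr hδ.le)).tendsto.comp hs).mul_const C
  rw [Real.zero_rpow hδ.ne', zero_mul] at h1
  exact h1.eventually (eventually_le_nhds hη)

lemma growthB2 {b : ℝ} {u0 : ℝ → ℝ} {γ : ℝ} {N : ℕ} (hb : 0 < b)
    (hc : ContinuousOn u0 (Ioo (-b) b)) (hN : γ < N)
    (h1 : ∃ C : ℝ, ∀ᶠ x in 𝓝[<] b, u0 x * (b - x) ^ γ ≤ C)
    (h2 : ∃ C : ℝ, ∀ᶠ x in 𝓝[>] (-b), u0 x * (b + x) ^ γ ≤ C) {η : ℝ} (hη : 0 < η) :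
    ∃ M, ∀ x ∈ Ioo (-b) b, u0 x ≤ M + η * DD b N x := by
  obtain ⟨C1, h1⟩ := h1
  obtain ⟨C2, h2⟩ := h2
  have hd : 0 < (N : ℝ) - γ := by linarith
  have e1 : ∀ᶠ x in 𝓝[<] b, x ∈ Ioo (-b) b := Ioo_mem_nhdsLT (by linarith)
  have e2 : ∀ᶠ x in 𝓝[>] (-b), x ∈ Ioo (-b) b := Ioo_mem_nhdsGT (by linarith)
  have t1 : Tendsto (fun x => b - x) (𝓝[<] b) (𝓝 0) := by
    have : Tendsto (fun x => b - x) (𝓝 b) (𝓝 (b - b)) := (continuous_const.sub continuous_id).tendsto b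
    rw [sub_self] at this
    exact this.mono_left nhdsWithin_le_nhds
  have t2 : Tendsto (fun x => b + x) (𝓝[>] (-b)) (𝓝 0) := by
    have : Tendsto (fun x => b + x) (𝓝 (-b)) (𝓝 (b + -b)) :=
      (continuous_const.add continuous_id).tendsto (-b)
    rw [add_neg_cancel] at this
    exact this.mono_left nhdsWithin_le_nhds
  obtain ⟨M, hM⟩ := bddIoo (h := fun x => u0 x - η * DD b N x) hb
    (hc.sub (continuousOn_const.mul (DD_C2 b N).continuousOn)) (K1 := 0) (K2 := 0)
    (by
      filter_upwards [e1, h1, ev_small (C := C1) hd hη t1] with x hx hu hs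
      have hp := pow_growth (by linarith [hx.2]) hu hs
      have hq : 0 ≤ η * ee b (-1) x ^ N := mul_nonneg hη.le (pow_nonneg (ee_pos (Or.inr rfl) hx).le N)
      have he : ee b 1 x = (b - x)⁻¹ := by unfold ee; rw [one_mul]
      unfold DD
      rw [he, mul_add]
      linarith)
    (by
      filter_upwards [e2, h2, ev_small (C := C2) hd hη t2] with x hx hu hs
      have hp := pow_growth (by linarith [hx.1]) hu hs
      have hq : 0 ≤ η * ee b 1 x ^ N := mul_nonneg hη.le (pow_nonneg (ee_pos (Or.inl rfl) hx).le N)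
      have he : ee b (-1) x = (b + x)⁻¹ := by unfold ee; congr 1; ring
      unfold DD
      rw [he, mul_add]
      linarith)
  exact ⟨M, fun x hx => by have := hM x hx; linarith⟩

lemma existsN {α γ : ℝ} (hα : 1 < α) :
    ∃ N : ℕ, 1 ≤ N ∧ (N : ℝ) + 2 ≤ (N + 1) * α ∧ γ < N := by
  obtain ⟨N, hN⟩ := exists_nat_gt (max (max 1 γ) (1 / (α - 1)))
  have h1 : 1 < (N : ℝ) := lt_of_le_of_lt (le_trans (le_max_left _ _) (le_max_left _ _)) hN
  have h2 : γ < (N : ℝ) := lt_of_le_of_lt (le_trans (le_max_right _ _) (le_max_left _ _)) hN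
  have h3 : 1 / (α - 1) < (N : ℝ) := lt_of_le_of_lt (le_max_right _ _) hN
  rw [div_lt_iff₀ (by linarith)] at h3
  refine ⟨N, by exact_mod_cast h1.le, ?_, h2⟩
  nlinarith

lemma existence_aux {b α m : ℝ} {f g u0 : ℝ → ℝ} {N : ℕ} (hb : 0 < b) (hf : A1 f) (hα1 : 1 < α)
    (hα2 : α ≤ 2) (hg : A2 g α) (hN1 : 1 ≤ N) (hN : (N : ℝ) + 2 ≤ (N + 1) * α)
    (hu0 : ContinuousOn u0 (Ioo (-b) b)) (hm : ∀ x ∈ Ioo (-b) b, m ≤ u0 x)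
    (hgr : ∀ η : ℝ, 0 < η → ∃ M, ∀ x ∈ Ioo (-b) b, u0 x ≤ M + η * DD b N x) :
    ∃ u : ℝ × ℝ → ℝ, IsVSol b f g u0 u := by
  have hDc := (DD_C2 b N).continuousOn
  have hm0 : Cls b f g u0 (DD b N) (fun _ => m) := by
    have h := (cls_max (b := b) (g := g) (u0 := u0) hf.2.1 hf.2.2.1 hg.2.1 (DD_nonneg N) (m := m)
      (M := m) (ψ := fun _ => m) continuousOn_const hm hm (fun _ _ => le_rfl)
      (fun p _ h => absurd h (lt_irrefl _))).1
    simpa using h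
  refine perron hb hf.1 hf.2.1 hg.1 hg.2.1 (DD_nonneg N) hDc hm0 ?_ ?_ ?_ ?_ ?_
  · intro x0 hx0 ε hε
    have hD := DD_nonneg N x0 hx0
    obtain ⟨A, B, hA, hB, H⟩ := upper hb hf hα1 hg hN1 hN hu0 hgr hx0 (half_pos hε)
      (show 0 < ε / 2 / (DD b N x0 + 1) by positivity)
    refine ⟨_, ?_, ?_, H⟩
    · have hfst : ContinuousOn (fun p : ℝ × ℝ => DD b N p.1) (Q0set b) :=
        hDc.comp continuousOn_fst (fun p hp => hp.1)
      exact (ContinuousOn.add (Continuous.continuousOn (by fun_prop))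
        (continuousOn_const.mul hfst)).add (Continuous.continuousOn (by fun_prop))
    · have h1 : ε / 2 / (DD b N x0 + 1) * DD b N x0 ≤ ε / 2 := by
        rw [div_mul_eq_mul_div, div_le_iff₀ (by linarith)]
        nlinarith
      simp only [sub_self, mul_zero]
      nlinarith
  · intro η hη
    obtain ⟨A, B, hA, hB, H⟩ := upper hb hf hα1 hg hN1 hN hu0 hgr
      (x0 := 0) ⟨by linarith, hb⟩ one_pos hη
    refine ⟨u0 0 + 1 + A * b ^ 2, B, fun v hv p hp => (H v hv p hp).trans ?_⟩
    have h1 : (p.1 - 0) ^ 2 ≤ b ^ 2 := by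
      have h2 := hp.1.1
      have h3 := hp.1.2
      nlinarith
    have h2 := mul_le_mul_of_nonneg_left h1 hA
    linarith
  · intro x0 hx0 ε hε
    exact lower hf hα1 hg (DD_nonneg N) hu0 hm hx0 hε
  · intro t ht M
    obtain ⟨v, h1, h2, h3⟩ := boundary (D := DD b N) hf hα1 hα2 hg (DD_nonneg N) hm (Or.inl rfl) ht M
    rw [one_mul] at h3
    exact ⟨v, h1, h2, h3.filter_mono nhdsWithin_le_nhds⟩
  · intro t ht M
    obtain ⟨v, h1, h2, h3⟩ := boundary (D := DD b N) hf hα1 hα2 hg (DD_nonneg N) hm (Or.inr rfl) ht M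
    rw [neg_one_mul] at h3
    exact ⟨v, h1, h2, h3.filter_mono nhdsWithin_le_nhds⟩

/-- existence for `1 < α ≤ 2` under (B1) or (B2). -/
theorem existence_alpha_between (b α : ℝ) (f g u0 : ℝ → ℝ)
    (hb : 0 < b) (hf : A1 f) (hα1 : 1 < α) (hα2 : α ≤ 2) (hg : A2 g α)
    (hu0 : B1 b u0 ∨ B2 b u0) :
    ∃ u : ℝ × ℝ → ℝ, IsVSol b f g u0 u := by
  rcases hu0 with h | ⟨hc, ht1, ht2, γ, hγ, h1, h2⟩
  · obtain ⟨N, hN1, hN, -⟩ := existsN (γ := 0) hα1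
    obtain ⟨M, hM⟩ := isCompact_Icc.bddAbove_image h
    obtain ⟨m, hm⟩ := isCompact_Icc.bddBelow_image h
    refine existence_aux (m := m) hb hf hα1 hα2 hg hN1 hN (ContinuousOn.mono h Ioo_subset_Icc_self)
      (fun x hx => hm ⟨x, Ioo_subset_Icc_self hx, rfl⟩) (fun η hη => ⟨M, fun x hx => ?_⟩)
    have h3 : u0 x ≤ M := hM ⟨x, Ioo_subset_Icc_self hx, rfl⟩
    have h4 := mul_nonneg hη.le (DD_nonneg N x hx)
    linarith
  · obtain ⟨N, hN1, hN, hNγ⟩ := existsN (γ := γ) hα1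
    obtain ⟨m, hm⟩ := bddIoo (h := fun x => -u0 x) hb hc.neg (K1 := 0) (K2 := 0)
      ((ht1.eventually (eventually_ge_atTop 0)).mono fun x hx => by linarith)
      ((ht2.eventually (eventually_ge_atTop 0)).mono fun x hx => by linarith)
    exact existence_aux (m := -m) hb hf hα1 hα2 hg hN1 hN hc
      (fun x hx => by have := hm x hx; linarith) (fun η hη => growthB2 hb hc hNγ h1 h2 hη)
end
end
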